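/- arXiv:2301.05771 — 2 statements merged into one kernel-verified Lean document; each statement's English description precedes it below -/
import Mathlib

section
/- Let A be a commutative noetherian ring, 𝔞 an ideal, x = x_1,…,x_t ∈ 𝔞 with dim A/(x) ≤ 1, and let f : M → N be a homomorphism of A-modules such that M and N are 𝔞-torsion and all Koszul cohomology modules H^i(x,M) and H^i(x,N) are 𝔞-cofinite. Then all Koszul cohomology modules H^i(x, Ker f) and H^i(x, Coker f) are 𝔞-cofinite (and Ker f and Coker f are 𝔞-torsion). In other words, the category 𝒦ℳ(x,𝔞,A)_cof ∩ 𝒯(𝔞) is abelian. -/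
open CategoryTheory Limits

noncomputable section

variable {A : Type} [CommRing A]

/-- The `i`-th term of the Koszul cochain complex `Hom_A(K_•(x), M)`. -/
abbrev KoszulCochain {t : ℕ} (x : Fin t → A) (M : Type) [AddCommGroup M] [Module A M]
    (i : ℕ) : Type :=
  {s : Finset (Fin t) // s.card = i} → M

/-- The Koszul cochain differential. -/
def koszulD {t : ℕ} (x : Fin t → A) (M : Type) [AddCommGroup M] [Module A M] (i : ℕ) :
    KoszulCochain x M i →ₗ[A] KoszulCochain x M (i + 1) :=
  LinearMap.pi fun s => ∑ j ∈ s.1.attach,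
    (((-1 : A) ^ ((s.1.filter (fun k => k < j.1)).card)) * x j.1) •
      (LinearMap.proj
        (⟨s.1.erase j.1, by simp [Finset.card_erase_of_mem j.2, s.2]⟩ :
          {s : Finset (Fin t) // s.card = i}) :
        KoszulCochain x M i →ₗ[A] M)

/-- The boundaries in degree `i` of the Koszul cochain complex. -/
def koszulBoundary {t : ℕ} (x : Fin t → A) (M : Type) [AddCommGroup M] [Module A M] :
    (i : ℕ) → Submodule A (KoszulCochain x M i)
  | 0 => ⊥
  | j + 1 => LinearMap.range (koszulD x M j)

/-- The `i`-th Koszul cohomology `H^i(x, M)` of `M` with respect to `x`. -/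
abbrev KoszulCohomology {t : ℕ} (x : Fin t → A) (M : Type) [AddCommGroup M] [Module A M]
    (i : ℕ) : Type :=
  LinearMap.ker (koszulD x M i) ⧸
    (koszulBoundary x M i).comap (LinearMap.ker (koszulD x M i)).subtype

/-- `Ext_A^i(A/𝔞, M)` as an `A`-module. -/
abbrev extQuot (𝔞 : Ideal A) (M : Type) [AddCommGroup M] [Module A M] (i : ℕ) : Type :=
  ↥(((_root_.Ext A (ModuleCat A) i).obj
    (Opposite.op (ModuleCat.of A (A ⧸ 𝔞)))).obj (ModuleCat.of A M))

/-- `M` is an `𝔞`-cofinite `A`-module: `Supp M ⊆ V(𝔞)` and all `Ext_A^i(A/𝔞, M)`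
are finitely generated. -/
def IsCofinite (𝔞 : Ideal A) (M : Type) [AddCommGroup M] [Module A M] : Prop :=
  Module.support A M ⊆ PrimeSpectrum.zeroLocus (𝔞 : Set A) ∧
    ∀ i : ℕ, Module.Finite A (extQuot 𝔞 M i)

/-- Finiteness of the derived-category version of Ext. -/
def EF (𝔞 : Ideal A) (i : ℕ) (M : Type) [AddCommGroup M] [Module A M] : Prop :=
  Module.Finite A (Abelian.Ext (ModuleCat.of A (A ⧸ 𝔞)) (ModuleCat.of A M) i)

lemma extMk_zero_iff {X Y : ModuleCat.{0} A} (R : ProjectiveResolution X)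
    (f : R.complex.X 0 ⟶ Y) (hf : R.complex.d 1 0 ≫ f = 0) :
    R.extMk f 1 rfl hf = 0 ↔ f = 0 := by
  constructor
  · intro h
    simp only [← R.extEquivCohomologyClass.apply_eq_iff_eq,
      ProjectiveResolution.extEquivCohomologyClass_extMk,
      ProjectiveResolution.extEquivCohomologyClass_zero,
      CochainComplex.HomComplex.CohomologyClass.mk_eq_zero_iff] at h
    rw [CochainComplex.HomComplex.Cocycle.toSingleMk_mem_coboundaries_iff _ _ _ _ _ 1 (by simp)] at h
    obtain ⟨g, hg⟩ := h
    have hz : IsZero (R.cochainComplex.X 1) := by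
      exact CochainComplex.isZero_of_isStrictlyLE _ 0 1
    have : (R.cochainComplexXIso (-(0:ℕ)) 0 rfl).hom ≫ f = 0 := by
      rw [← hg, hz.eq_of_src g 0, comp_zero]
    simpa using this
  · rintro rfl
    simp

/-- cocycle to ext -/
def cocToExt {X Y : ModuleCat.{0} A} (R : ProjectiveResolution X) (n : ℕ) :
    LinearMap.ker (Linear.leftComp A Y (R.complex.d (n+1) n)) →ₗ[A] Abelian.Ext X Y n where
  toFun f := R.extMk f.1 (n+1) rfl f.2
  map_add' f g := (R.add_extMk _ _ _ _ _ _).symm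
  map_smul' r f := by
    simp only [RingHom.id_apply]
    rw [Abelian.Ext.smul_eq_comp_mk₀]
    refine Eq.trans ?_ (R.extMk_comp_mk₀ f.1 (n+1) rfl f.2 (r • 𝟙 Y)).symm
    congr 1

lemma finite_bridge {X Y : ModuleCat.{0} A} (n : ℕ) :
    Module.Finite A (((_root_.Ext A (ModuleCat A) n).obj (Opposite.op X)).obj Y) ↔
    Module.Finite A (Abelian.Ext X Y n) := by
  let R := ProjectiveResolution.of X
  let K := R.complex.linearYonedaObj A Y
  have e1 : ((_root_.Ext A (ModuleCat A) n).obj (Opposite.op X)).obj Y ≃ₗ[A]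
      (K.sc n).moduleCatLeftHomologyData.H :=
    ((R.isoExt n Y) ≪≫ (K.sc n).moduleCatHomologyIso).toLinearEquiv
  have hker : ∀ f : R.complex.X n ⟶ Y, (K.sc n).g.hom f = 0 → R.complex.d (n+1) n ≫ f = 0 := by
    intro f hf
    have hrel : (ComplexShape.up ℕ).next n = n+1 := by simp
    have h2 : ∀ m, m = n+1 → (K.d n m).hom f = 0 → R.complex.d (n+1) n ≫ f = 0 := by
      rintro m rfl h
      exact h
    exact h2 _ hrel hf
  have hker' : ∀ f : R.complex.X n ⟶ Y, R.complex.d (n+1) n ≫ f = 0 → (K.sc n).g.hom f = 0 := by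
    intro f hf
    have hrel : (ComplexShape.up ℕ).next n = n+1 := by simp
    have h2 : ∀ m, m = n+1 → R.complex.d (n+1) n ≫ f = 0 → (K.d n m).hom f = 0 := by
      rintro m rfl h
      exact h
    exact h2 _ hrel hf
  let φ : LinearMap.ker (K.sc n).g.hom →ₗ[A] Abelian.Ext X Y n :=
    { toFun := fun f => cocToExt R n ⟨f.1, hker f.1 f.2⟩
      map_add' := fun f g => (cocToExt R n).map_add ⟨f.1, hker f.1 f.2⟩ ⟨g.1, hker g.1 g.2⟩
      map_smul' := fun r f => (cocToExt R n).map_smul r ⟨f.1, hker f.1 f.2⟩ }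
  have hφs : Function.Surjective φ := by
    intro α
    obtain ⟨f, hf, h⟩ := R.extMk_surjective α (n+1) rfl
    exact ⟨⟨f, hker' f hf⟩, h⟩
  have hφk : LinearMap.range (K.sc n).moduleCatToCycles = LinearMap.ker φ := by
    ext ⟨f, hf⟩
    have hf' := hker f hf
    have key : f ∈ LinearMap.range (K.sc n).f.hom ↔ R.extMk f (n+1) rfl hf' = 0 := by
      cases n with
      | zero =>
        refine Iff.trans ?_ (extMk_zero_iff R f hf').symm
        have : (K.sc 0).f = 0 := K.shape _ _ (by simp)
        rw [this]
        constructor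
        · rintro ⟨g, hg⟩
          exact hg.symm
        · rintro rfl
          exact Submodule.zero_mem _
      | succ p =>
        refine Iff.trans ?_ (R.extMk_eq_zero_iff f _ rfl hf' p rfl).symm
        have hrel : (ComplexShape.up ℕ).prev (p+1) = p := by simp
        have h2 : ∀ m, m = p → (f ∈ LinearMap.range (K.d m (p+1)).hom ↔
            ∃ g : R.complex.X p ⟶ Y, R.complex.d (p+1) p ≫ g = f) := by
          rintro m rfl
          exact Iff.rfl
        exact h2 _ hrel
    refine Iff.trans ?_ key
    constructor
    · rintro ⟨g, hg⟩
      exact ⟨g, congrArg Subtype.val hg⟩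
    · rintro ⟨g, hg⟩
      exact ⟨g, Subtype.ext hg⟩
  have e2 : (K.sc n).moduleCatLeftHomologyData.H ≃ₗ[A] Abelian.Ext X Y n :=
    (Submodule.quotEquivOfEq _ _ hφk).trans (φ.quotKerEquivOfSurjective hφs)
  exact Module.Finite.equiv_iff (e1.trans e2)

lemma isCofinite_iff (𝔞 : Ideal A) (M : Type) [AddCommGroup M] [Module A M] :
    IsCofinite 𝔞 M ↔ Module.support A M ⊆ PrimeSpectrum.zeroLocus (𝔞 : Set A) ∧
      ∀ i, EF 𝔞 i M := by
  unfold IsCofinite EF extQuot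
  simp only [finite_bridge]

lemma finite_mid [IsNoetherianRing A] {X Y Z : Type*} [AddCommGroup X] [Module A X]
    [AddCommGroup Y] [Module A Y] [AddCommGroup Z] [Module A Z]
    (u : X →ₗ[A] Y) (v : Y →ₗ[A] Z) (hX : Module.Finite A X) (hZ : Module.Finite A Z)
    (h : ∀ y, v y = 0 → ∃ x, u x = y) : Module.Finite A Y := by
  have h1 : LinearMap.ker v ≤ LinearMap.range u := fun y hy => h y hy
  have : IsNoetherian A (LinearMap.range u) := inferInstance
  have h2 : IsNoetherian A (LinearMap.ker v) := isNoetherian_of_le h1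
  have h3 : IsNoetherian A Y := isNoetherian_of_range_eq_ker (LinearMap.ker v).subtype v (by simp)
  exact inferInstance

section LES
set_option linter.unusedSectionVars false
variable [IsNoetherianRing A] (𝔞 : Ideal A)
  {M₁ M₂ M₃ : Type} [AddCommGroup M₁] [Module A M₁] [AddCommGroup M₂] [Module A M₂]
  [AddCommGroup M₃] [Module A M₃] (f : M₁ →ₗ[A] M₂) (g : M₂ →ₗ[A] M₃)

/-- the map on Ext -/
def extMap (i : ℕ) (f : M₁ →ₗ[A] M₂) :
    Abelian.Ext (ModuleCat.of A (A ⧸ 𝔞)) (ModuleCat.of A M₁) i →ₗ[A]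
    Abelian.Ext (ModuleCat.of A (A ⧸ 𝔞)) (ModuleCat.of A M₂) i :=
  (Abelian.Ext.mk₀ (ModuleCat.ofHom f)).postcompOfLinear A _ (add_zero i)

lemma extMap_comp (i : ℕ) (x) :
    extMap 𝔞 i (g ∘ₗ f) x = extMap 𝔞 i g (extMap 𝔞 i f x) := by
  simp [extMap, ModuleCat.ofHom_comp]

lemma extMap_id (i : ℕ) (x) : extMap 𝔞 i (LinearMap.id (R := A) (M := M₁)) x = x := by
  simp [extMap]

lemma extMap_add (i : ℕ) (f f' : M₁ →ₗ[A] M₂) (x) :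
    extMap 𝔞 i (f + f') x = extMap 𝔞 i f x + extMap 𝔞 i f' x := by
  have : Abelian.Ext.mk₀ (ModuleCat.ofHom f + ModuleCat.ofHom f') =
    Abelian.Ext.mk₀ (ModuleCat.ofHom f) + Abelian.Ext.mk₀ (ModuleCat.ofHom f') :=
    Abelian.Ext.mk₀_add _ _
  simp [extMap, ModuleCat.ofHom_add, this]

lemma extMap_sum {ι : Type} (s : Finset ι) (i : ℕ) (F : ι → M₁ →ₗ[A] M₂) (x) :
    extMap 𝔞 i (∑ j ∈ s, F j) x = ∑ j ∈ s, extMap 𝔞 i (F j) x := by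
  classical
  induction s using Finset.induction_on with
  | empty =>
    have := extMap_add 𝔞 i (0 : M₁ →ₗ[A] M₂) 0 x
    simpa using this
  | insert a s ha ih => rw [Finset.sum_insert ha, Finset.sum_insert ha, extMap_add, ih]

lemma extMap_smul (i : ℕ) (r : A) (f : M₁ →ₗ[A] M₂) (x) :
    extMap 𝔞 i (r • f) x = r • extMap 𝔞 i f x := by
  have : ModuleCat.ofHom (r • f) = r • ModuleCat.ofHom f := rfl
  simp [extMap, this, Abelian.Ext.mk₀_smul]

lemma ext_smul_eq_zero (i : ℕ) (r : A) (hr : r ∈ 𝔞)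
    (x : Abelian.Ext (ModuleCat.of A (A ⧸ 𝔞)) (ModuleCat.of A M₁) i) : r • x = 0 := by
  have h : r • 𝟙 (ModuleCat.of A (A ⧸ 𝔞)) = 0 := by
    rw [← ModuleCat.lsmul_eq_smul_id, (Module.mem_annihilator_iff_lsmul_eq_zero).mp ?_]
    · rfl
    · show r ∈ Module.annihilator A (A ⧸ 𝔞)
      rwa [Ideal.annihilator_quotient]
  have smul_eq : r • x = (Abelian.Ext.mk₀ (r • 𝟙 _)).comp x (zero_add i) := by
    simp [Abelian.Ext.mk₀_smul]
  rw [smul_eq, h]; simp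

/-- the short complex of a short exact sequence -/
abbrev scOf (hfg : Function.Exact f g) : ShortComplex (ModuleCat A) :=
  ShortComplex.mk (ModuleCat.ofHom f) (ModuleCat.ofHom g) (by
    ext x; exact hfg.apply_apply_eq_zero x)

lemma scOf_shortExact (hf : Function.Injective f) (hfg : Function.Exact f g)
    (hg : Function.Surjective g) : (scOf f g hfg).ShortExact :=
  ModuleCat.shortComplex_shortExact _ hfg hf hg

lemma ext_exact₂ (hf : Function.Injective f) (hfg : Function.Exact f g)
    (hg : Function.Surjective g) (i : ℕ) (x) (hx : extMap 𝔞 i g x = 0) :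
    ∃ y, extMap 𝔞 i f y = x :=
  Abelian.Ext.covariant_sequence_exact₂ _ (scOf_shortExact f g hf hfg hg) x hx

lemma ext_conn (hf : Function.Injective f) (hfg : Function.Exact f g)
    (hg : Function.Surjective g) (i : ℕ) :
    ∃ δ : Abelian.Ext (ModuleCat.of A (A ⧸ 𝔞)) (ModuleCat.of A M₃) i →ₗ[A]
      Abelian.Ext (ModuleCat.of A (A ⧸ 𝔞)) (ModuleCat.of A M₁) (i+1),
    (∀ x, extMap 𝔞 (i+1) f x = 0 → ∃ y, δ y = x) ∧
    (∀ x, δ x = 0 → ∃ y, extMap 𝔞 i g y = x) :=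
  ⟨(scOf_shortExact f g hf hfg hg).extClass.postcompOfLinear A _ rfl,
    fun x hx => Abelian.Ext.covariant_sequence_exact₁ _ (scOf_shortExact f g hf hfg hg) x hx rfl,
    fun x hx => Abelian.Ext.covariant_sequence_exact₃ _ (scOf_shortExact f g hf hfg hg) x rfl hx⟩

lemma EF.mid (hf : Function.Injective f) (hfg : Function.Exact f g)
    (hg : Function.Surjective g) {i : ℕ} (h1 : EF 𝔞 i M₁) (h3 : EF 𝔞 i M₃) : EF 𝔞 i M₂ :=
  finite_mid (extMap 𝔞 i f) (extMap 𝔞 i g) h1 h3 (ext_exact₂ 𝔞 f g hf hfg hg i)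

lemma EF.right (hf : Function.Injective f) (hfg : Function.Exact f g)
    (hg : Function.Surjective g) {i : ℕ} (h2 : EF 𝔞 i M₂) (h1 : EF 𝔞 (i+1) M₁) : EF 𝔞 i M₃ := by
  obtain ⟨δ, -, hδ⟩ := ext_conn 𝔞 f g hf hfg hg i
  exact finite_mid (extMap 𝔞 i g) δ h2 h1 hδ

lemma EF.left (hf : Function.Injective f) (hfg : Function.Exact f g)
    (hg : Function.Surjective g) {i : ℕ} (h3 : EF 𝔞 i M₃) (h2 : EF 𝔞 (i+1) M₂) :
    EF 𝔞 (i+1) M₁ := by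
  obtain ⟨δ, hδ, -⟩ := ext_conn 𝔞 f g hf hfg hg i
  exact finite_mid δ (extMap 𝔞 (i+1) f) h3 h2 hδ

lemma EF.zero_of_injective (hf : Function.Injective f) (h2 : EF 𝔞 0 M₂) : EF 𝔞 0 M₁ := by
  have : Mono (ModuleCat.ofHom f) := (ModuleCat.mono_iff_injective _).2 hf
  have h := Abelian.Ext.postcomp_mk₀_injective_of_mono (ModuleCat.of A (A ⧸ 𝔞)) (ModuleCat.ofHom f)
  have h' : Function.Injective (extMap 𝔞 0 f) := h
  unfold EF at *
  exact Module.Finite.of_injective _ h'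

lemma EF.equiv (e : M₁ ≃ₗ[A] M₂) {i : ℕ} (h : EF 𝔞 i M₁) : EF 𝔞 i M₂ := by
  unfold EF at *
  refine Module.Finite.of_surjective (extMap 𝔞 i e.toLinearMap) fun x =>
    ⟨extMap 𝔞 i e.symm.toLinearMap x, ?_⟩
  rw [← extMap_comp]
  simp [extMap_id]

lemma EF.of_finite (h : Module.Finite A M₁) (i : ℕ) : EF 𝔞 i M₁ := by
  unfold EF
  have : Module.Finite A (ModuleCat.of A M₁) := h
  infer_instance

lemma EF.pi {ι : Type} [Fintype ι] {i : ℕ} (h : EF 𝔞 i M₁) : EF 𝔞 i (ι → M₁) := by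
  classical
  have : Module.Finite A (Abelian.Ext (ModuleCat.of A (A ⧸ 𝔞)) (ModuleCat.of A M₁) i) := h
  refine Module.Finite.of_injective (LinearMap.pi fun j : ι =>
    extMap 𝔞 i (LinearMap.proj (R := A) (φ := fun _ : ι => M₁) j)) ?_
  rw [← LinearMap.ker_eq_bot, LinearMap.ker_eq_bot']
  intro x hx
  have h1 : (LinearMap.id : (ι → M₁) →ₗ[A] (ι → M₁)) =
      ∑ j, LinearMap.single A (fun _ : ι => M₁) j ∘ₗ LinearMap.proj j := by
    ext k m l
    simp [Pi.single_apply]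
  rw [← extMap_id 𝔞 i x, h1, extMap_sum]
  refine Finset.sum_eq_zero fun j _ => ?_
  rw [extMap_comp, show extMap 𝔞 i (LinearMap.proj j) x = 0 from congrFun hx j, map_zero]

/-- The key vanishing lemma. -/
lemma EF.of_smul_map {ι : Type} [Fintype ι] (c : ι → A) (hc : ∀ j, c j ∈ 𝔞)
    (d : M₁ →ₗ[A] (ι → M₁)) (hd : ∀ m j, d m j = c j • m) {i : ℕ}
    (hk : EF 𝔞 (i+1) (LinearMap.ker d)) (hq : EF 𝔞 i ((ι → M₁) ⧸ LinearMap.range d)) :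
    EF 𝔞 (i+1) M₁ := by
  classical
  have hd0 : ∀ x, extMap 𝔞 (i+1) d x = 0 := by
    intro x
    have : d = ∑ j, c j • LinearMap.single A (fun _ : ι => M₁) j := by
      ext m l
      simp [hd, Pi.single_apply]
    rw [this, extMap_sum]
    refine Finset.sum_eq_zero fun j _ => ?_
    rw [extMap_smul, ext_smul_eq_zero 𝔞 _ _ (hc j)]
  obtain ⟨δ, hδ, -⟩ := ext_conn 𝔞 (LinearMap.range d).subtype (LinearMap.range d).mkQ
    (Subtype.val_injective) (LinearMap.exact_subtype_mkQ _) (Submodule.mkQ_surjective _) i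
  have hr := ext_exact₂ 𝔞 (LinearMap.ker d).subtype d.rangeRestrict
    (Subtype.val_injective) (by
      intro y; rw [← LinearMap.mem_ker, LinearMap.ker_rangeRestrict]; simp)
      d.surjective_rangeRestrict (i+1)
  let v : Abelian.Ext (ModuleCat.of A (A ⧸ 𝔞)) (ModuleCat.of A M₁) (i+1) →ₗ[A]
    LinearMap.range δ := (extMap 𝔞 (i+1) d.rangeRestrict).codRestrict _ (by
      intro x
      obtain ⟨y, hy⟩ := hδ (extMap 𝔞 (i+1) d.rangeRestrict x) (by
        rw [← extMap_comp]; exact hd0 x)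
      exact ⟨y, hy⟩)
  have hq' : Module.Finite A (Abelian.Ext (ModuleCat.of A (A ⧸ 𝔞))
    (ModuleCat.of A ((ι → M₁) ⧸ LinearMap.range d)) i) := hq
  refine finite_mid (extMap 𝔞 (i+1) (LinearMap.ker d).subtype) v hk inferInstance ?_
  intro y hy
  exact hr y (congrArg Subtype.val hy)

end LES

/-- EF 0 as finiteness of the 𝔞-torsion. -/
lemma EF_zero_iff (𝔞 : Ideal A) (M : Type) [AddCommGroup M] [Module A M] :
    EF 𝔞 0 M ↔ Module.Finite A (Submodule.torsionBySet A M (𝔞 : Set A)) := by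
  unfold EF
  have e : Abelian.Ext (ModuleCat.of A (A ⧸ 𝔞)) (ModuleCat.of A M) 0 ≃ₗ[A] ((A ⧸ 𝔞) →ₗ[A] M) :=
    Abelian.Ext.linearEquiv₀.trans ModuleCat.homLinearEquiv
  rw [Module.Finite.equiv_iff e]
  let φ : ((A ⧸ 𝔞) →ₗ[A] M) →ₗ[A] Submodule.torsionBySet A M (𝔞 : Set A) :=
    { toFun := fun f => ⟨f 1, by
        rw [Submodule.mem_torsionBySet_iff]
        rintro ⟨a, ha⟩
        have : f (a • 1) = 0 := by
          rw [Algebra.smul_def, mul_one]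
          have : algebraMap A (A ⧸ 𝔞) a = 0 := Ideal.Quotient.eq_zero_iff_mem.2 ha
          rw [this, map_zero]
        simpa using this⟩
      map_add' := fun f g => rfl
      map_smul' := fun r f => rfl }
  have hφ : Function.Bijective φ := by
    constructor
    · intro f g h
      have h : f 1 = g 1 := congrArg Subtype.val h
      ext
      simpa using h
    · rintro ⟨m, hm⟩
      rw [Submodule.mem_torsionBySet_iff] at hm
      refine ⟨Submodule.liftQ 𝔞 (LinearMap.toSpanSingleton A M m) ?_, ?_⟩
      · intro a ha
        exact hm ⟨a, ha⟩
      · apply Subtype.ext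
        change Submodule.liftQ 𝔞 (LinearMap.toSpanSingleton A M m) _ (Submodule.Quotient.mk 1) = m
        exact (Submodule.liftQ_apply 𝔞 (LinearMap.toSpanSingleton A M m) 1).trans (one_smul A m)
  exact Module.Finite.equiv_iff (LinearEquiv.ofBijective φ hφ)

section gen
variable {R : Type*} [CommRing R] {M : Type*} [AddCommGroup M] [Module R M]

/-- elementwise 𝔞-torsion -/
def Tors {R : Type*} [CommRing R] (𝔞 : Ideal R) (M : Type*) [AddCommGroup M] [Module R M] : Prop :=
  ∀ a ∈ 𝔞, ∀ m : M, ∃ n : ℕ, a ^ n • m = 0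

lemma tors_iff (𝔞 : Ideal R) :
    Module.support R M ⊆ PrimeSpectrum.zeroLocus (𝔞 : Set R) ↔ Tors 𝔞 M := by
  constructor
  · intro h a ha m
    have : a ∈ ((R ∙ m).annihilator).radical := by
      rw [Ideal.radical_eq_sInf, Ideal.mem_sInf]
      rintro p ⟨hp, hpp⟩
      have : (⟨p, hpp⟩ : PrimeSpectrum R) ∈ Module.support R M :=
        Module.mem_support_iff_exists_annihilator.2 ⟨m, hp⟩
      exact h this ha
    obtain ⟨n, hn⟩ := this
    exact ⟨n, (Submodule.mem_annihilator_span_singleton m _).1 hn⟩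
  · intro h p hp a ha
    obtain ⟨m, hm⟩ := Module.mem_support_iff_exists_annihilator.1 hp
    obtain ⟨n, hn⟩ := h a ha m
    exact p.2.mem_of_pow_mem n (hm ((Submodule.mem_annihilator_span_singleton m _).2 hn))

lemma Tors.of_injective {𝔞 : Ideal R} {N : Type*} [AddCommGroup N] [Module R N]
    (f : N →ₗ[R] M) (hf : Function.Injective f) (h : Tors 𝔞 M) : Tors 𝔞 N := by
  intro a ha m
  obtain ⟨n, hn⟩ := h a ha (f m)
  exact ⟨n, hf (by simp [hn])⟩

lemma Tors.of_surjective {𝔞 : Ideal R} {N : Type*} [AddCommGroup N] [Module R N]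
    (f : M →ₗ[R] N) (hf : Function.Surjective f) (h : Tors 𝔞 M) : Tors 𝔞 N := by
  intro a ha m
  obtain ⟨m, rfl⟩ := hf m
  obtain ⟨n, hn⟩ := h a ha m
  exact ⟨n, by rw [← map_smul, hn, map_zero]⟩

lemma Tors.pi {𝔞 : Ideal R} {ι : Type*} [Fintype ι] (h : Tors 𝔞 M) : Tors 𝔞 (ι → M) := by
  intro a ha m
  choose n hn using fun j => h a ha (m j)
  refine ⟨∑ j, n j, funext fun j => ?_⟩
  have : n j ≤ ∑ j, n j := Finset.single_le_sum (f := n) (fun _ _ => Nat.zero_le _) (Finset.mem_univ j)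
  obtain ⟨k, hk⟩ := Nat.exists_eq_add_of_le this
  simp only [Pi.smul_apply, Pi.zero_apply]
  rw [hk, add_comm, pow_add, mul_smul, hn, smul_zero]

lemma artin_one (x : R) (hx : ∀ m : M, ∃ n : ℕ, x ^ n • m = 0)
    (h : IsArtinian R (Submodule.torsionBy R M x)) : IsArtinian R M := by
  rw [← monotone_stabilizes_iff_artinian]
  intro N
  -- W j n = x^n N_j ∩ (0:x)
  let W : ℕ → ℕ → Submodule R (Submodule.torsionBy R M x) := fun j n =>
    ((OrderDual.ofDual (N j)).map (LinearMap.lsmul R M (x ^ n))).comap (Submodule.subtype _)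
  have hN : ∀ i j, i ≤ j → OrderDual.ofDual (N j) ≤ OrderDual.ofDual (N i) := fun i j hij => N.2 hij
  have hW1 : ∀ i j n, i ≤ j → W j n ≤ W i n := fun i j n hij =>
    Submodule.comap_mono (Submodule.map_mono (hN i j hij))
  have hW2 : ∀ j n k, n ≤ k → W j k ≤ W j n := by
    rintro j n k hnk ⟨m, hm⟩ ⟨u, hu, hum⟩
    refine ⟨x ^ (k - n) • u, Submodule.smul_mem _ _ hu, ?_⟩
    rw [← hum]
    simp only [LinearMap.lsmul_apply]
    rw [← mul_smul, ← pow_add, Nat.add_sub_cancel' hnk]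
  have hst : ∀ f : ℕ → Submodule R (Submodule.torsionBy R M x), (∀ i j, i ≤ j → f j ≤ f i) →
      ∃ n, ∀ m, n ≤ m → f n = f m := by
    intro f hf
    exact IsArtinian.monotone_stabilizes ⟨fun n => OrderDual.toDual (f n), fun i j hij => hf i j hij⟩
  obtain ⟨d, hd⟩ := hst (fun n => W n n) (fun i j hij => (hW1 i j j hij).trans (hW2 i i j hij))
  choose e he using fun n => hst (fun j => W j n) (fun i j hij => hW1 i j n hij)
  let J := d + ∑ n ∈ Finset.range d, e n
  have hJ : ∀ j, J ≤ j → ∀ n, W J n ≤ W j n := by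
    intro j hj n
    by_cases hn : n < d
    · have h1 : e n ≤ J := (Finset.single_le_sum (f := e) (fun _ _ => Nat.zero_le _)
        (Finset.mem_range.2 hn)).trans (Nat.le_add_left _ _)
      rw [← he n J h1, ← he n j (h1.trans hj)]
    · push Not at hn
      have hdJ : d ≤ J := Nat.le_add_right _ _
      calc W J n ≤ W d d := (hW1 d J n hdJ).trans (hW2 d d n hn)
        _ = W (j + n) (j + n) := hd _ (by omega)
        _ ≤ W j n := (hW1 j (j+n) _ (by omega)).trans (hW2 j n _ (by omega))
  refine ⟨J, fun j hj => ?_⟩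
  have key : ∀ n : ℕ, ∀ u ∈ OrderDual.ofDual (N J), x ^ n • u = 0 → u ∈ OrderDual.ofDual (N j) := by
    intro n
    induction n with
    | zero => intro u _ h0; simp at h0; rw [h0]; exact Submodule.zero_mem _
    | succ n ih =>
      intro u hu h0
      have hm : x ^ n • u ∈ Submodule.torsionBy R M x := by
        rw [Submodule.mem_torsionBy_iff, ← mul_smul, ← pow_succ', h0]
      have : (⟨x ^ n • u, hm⟩ : Submodule.torsionBy R M x) ∈ W J n := ⟨u, hu, rfl⟩
      obtain ⟨v, hv, hvu⟩ := hJ j hj n this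
      have hvu : x ^ n • v = x ^ n • u := hvu
      have h2 : u - v ∈ OrderDual.ofDual (N j) :=
        ih (u - v) (Submodule.sub_mem _ hu (hN J j hj hv)) (by rw [smul_sub, hvu, sub_self])
      have := Submodule.add_mem _ h2 hv
      simpa using this
  apply le_antisymm
  · exact N.2 hj
  · intro u hu
    obtain ⟨n, hn⟩ := hx u
    exact key n u hu hn

lemma artin_finset (s : Finset R) (M : Type*) [AddCommGroup M] [Module R M]
    (hs : ∀ x ∈ s, ∀ m : M, ∃ n : ℕ, x ^ n • m = 0)
    (h : IsArtinian R (Submodule.torsionBySet R M (s : Set R))) : IsArtinian R M := by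
  classical
  induction s using Finset.induction_on with
  | empty =>
    have : Submodule.torsionBySet R M ((∅ : Finset R) : Set R) = ⊤ := by
      ext m; simp [Submodule.mem_torsionBySet_iff]
    rw [this] at h
    exact isArtinian_of_linearEquiv Submodule.topEquiv
  | insert x s hx ih =>
    refine ih (fun y hy => hs y (Finset.mem_insert_of_mem hy)) ?_
    refine artin_one x ?_ ?_
    · intro m
      obtain ⟨n, hn⟩ := hs x (Finset.mem_insert_self _ _) m.1
      exact ⟨n, Subtype.ext hn⟩
    · let φ : Submodule.torsionBy R (Submodule.torsionBySet R M (s : Set R)) x →ₗ[R]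
        Submodule.torsionBySet R M ((insert x s : Finset R) : Set R) :=
        LinearMap.codRestrict _ ((Submodule.subtype _) ∘ₗ (Submodule.subtype _)) (by
          rintro ⟨⟨m, hm⟩, hm'⟩
          rw [Submodule.mem_torsionBySet_iff] at hm ⊢
          rintro ⟨y, hy⟩
          rcases Finset.mem_insert.1 hy with rfl | hy
          · exact congrArg Subtype.val ((Submodule.mem_torsionBy_iff _ _).1 hm')
          · exact hm ⟨y, hy⟩)
      refine isArtinian_of_injective φ ?_
      intro u v huv
      have : (u.1.1 : M) = v.1.1 := congrArg (fun z : Submodule.torsionBySet R M ((insert x s : Finset R) : Set R) => (z : M)) huv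
      exact Subtype.ext (Subtype.ext this)

lemma artin_of_support [IsNoetherianRing R] [Module.Finite R M]
    (h : ∀ p ∈ Module.support R M, p.asIdeal.IsMaximal) : IsArtinian R M := by
  let I := Module.annihilator R M
  have hI : IsArtinianRing (R ⧸ I) := by
    rw [isArtinianRing_iff_krullDimLE_zero]
    refine Ring.KrullDimLE.mk₀ fun q hq => ?_
    have hp : (q.comap (Ideal.Quotient.mk I)).IsPrime := inferInstance
    have : (⟨_, hp⟩ : PrimeSpectrum R) ∈ Module.support R M := by
      rw [Module.support_eq_zeroLocus]
      intro a ha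
      change Ideal.Quotient.mk I a ∈ q
      rw [Ideal.Quotient.eq_zero_iff_mem.2 ha]
      exact q.zero_mem
    have hm := h _ this
    have hmc := Ideal.map_comap_of_surjective (Ideal.Quotient.mk I) Ideal.Quotient.mk_surjective q
    rcases Ideal.map_eq_top_or_isMaximal_of_surjective (Ideal.Quotient.mk I)
      Ideal.Quotient.mk_surjective hm with h1 | h1
    · exact absurd (hmc.symm.trans h1) hq.ne_top
    · exact hmc ▸ h1
  have hI' : IsArtinian R (R ⧸ I) :=
    isArtinian_of_surjective_algebraMap (R := R ⧸ I) (S := R) Ideal.Quotient.mk_surjective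
  obtain ⟨n, v, hv⟩ := Module.Finite.exists_fin (R := R) (M := M)
  let φ : (Fin n → R ⧸ I) →ₗ[R] M := ∑ i, Submodule.liftQ I (LinearMap.toSpanSingleton R M (v i))
    (fun a ha => (Module.mem_annihilator.1 ha) (v i)) ∘ₗ LinearMap.proj i
  refine isArtinian_of_surjective _ φ ?_
  rw [← LinearMap.range_eq_top, eq_top_iff, ← hv, Submodule.span_le]
  rintro _ ⟨i, rfl⟩
  classical
  refine ⟨Pi.single i (Submodule.Quotient.mk 1), ?_⟩
  simp only [φ, LinearMap.sum_apply, LinearMap.comp_apply, LinearMap.proj_apply]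
  rw [Finset.sum_eq_single i]
  · rw [Pi.single_eq_same]
    exact (Submodule.liftQ_apply I (LinearMap.toSpanSingleton R M (v i)) 1).trans (one_smul R _)
  · intro j _ hj
    rw [Pi.single_eq_of_ne hj, map_zero]
  · simp
end gen

section P3a
set_option linter.unusedSectionVars false
variable [IsNoetherianRing A] (𝔞 : Ideal A)

lemma finite_of_pow_smul (n : ℕ) : ∀ (M : Type) [AddCommGroup M] [Module A M], EF 𝔞 0 M →
    (∀ a ∈ 𝔞 ^ n, ∀ m : M, a • m = 0) → Module.Finite A M := by
  induction n with
  | zero =>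
    intro M _ _ _ h
    have : Subsingleton M := ⟨fun a b => by
      have ha := h 1 (by simp) a
      have hb := h 1 (by simp) b
      rw [one_smul] at ha hb
      rw [ha, hb]⟩
    infer_instance
  | succ n ih =>
    intro M _ _ h0 h
    let N : Submodule A M := 𝔞 • (⊤ : Submodule A M)
    have hN : Module.Finite A N := by
      refine ih N (EF.zero_of_injective 𝔞 N.subtype N.injective_subtype h0) ?_
      rintro a ha ⟨m, hm⟩
      apply Subtype.ext
      change a • m = 0
      refine Submodule.smul_induction_on hm ?_ ?_
      · intro r hr m _
        rw [← mul_smul]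
        exact h _ (by rw [pow_succ]; exact Ideal.mul_mem_mul ha hr) m
      · intro u v hu hv
        rw [smul_add, hu, hv, add_zero]
    obtain ⟨s, hs⟩ : 𝔞.FG := IsNoetherian.noetherian 𝔞
    have hs' : ∀ y : s, y.1 ∈ 𝔞 := fun y => hs ▸ Submodule.subset_span y.2
    let v : M →ₗ[A] (s → N) := LinearMap.pi fun y =>
      LinearMap.codRestrict N (LinearMap.lsmul A M y.1)
        (fun m => Submodule.smul_mem_smul (hs' y) trivial)
    have h0' := (EF_zero_iff 𝔞 M).1 h0
    refine finite_mid (Submodule.torsionBySet A M (𝔞 : Set A)).subtype v h0' inferInstance ?_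
    intro m hm
    have : m ∈ Submodule.torsionBySet A M (𝔞 : Set A) := by
      rw [← hs]
      change m ∈ Submodule.torsionBySet A M (Ideal.span (s : Set A) : Set A)
      rw [← Submodule.torsionBySet_eq_torsionBySet_span, Submodule.mem_torsionBySet_iff]
      intro y
      exact congrArg Subtype.val (congrFun hm y)
    exact ⟨⟨m, this⟩, rfl⟩

lemma finite_of_rad (M : Type) [AddCommGroup M] [Module A M] (h0 : EF 𝔞 0 M)
    (h : 𝔞 ≤ (Module.annihilator A M).radical) : Module.Finite A M := by
  obtain ⟨n, hn⟩ := Ideal.exists_pow_le_of_le_radical_of_fg h (IsNoetherian.noetherian 𝔞)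
  exact finite_of_pow_smul 𝔞 n M h0 fun a ha m => Module.mem_annihilator.1 (hn ha) m

lemma EF.of_smul {M : Type} [AddCommGroup M] [Module A M] (x : A) (hx : x ∈ 𝔞) {i : ℕ}
    (hk : EF 𝔞 (i + 1) (LinearMap.ker (LinearMap.lsmul A M x)))
    (hq : EF 𝔞 i (M ⧸ LinearMap.range (LinearMap.lsmul A M x))) : EF 𝔞 (i + 1) M := by
  let e : (Unit → M) ≃ₗ[A] M := LinearEquiv.funUnique Unit A M
  refine EF.of_smul_map 𝔞 (fun _ : Unit => x) (fun _ => hx)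
    (e.symm.toLinearMap ∘ₗ LinearMap.lsmul A M x) (fun m j => rfl) ?_ ?_
  · exact EF.equiv 𝔞 (LinearEquiv.ofEq _ _ (by rw [LinearEquiv.ker_comp])) hk
  · exact EF.equiv 𝔞 (Submodule.Quotient.equiv _ _ e.symm
      (LinearMap.range_comp _ _).symm) hq

lemma ann_lt_of_injective {M N : Type} [AddCommGroup M] [Module A M] [AddCommGroup N] [Module A N]
    (f : N →ₗ[A] M) (hf : Function.Injective f) (c : A) (hc : c ∉ Module.annihilator A M)
    (hN : ∀ m : N, c • m = 0) : Module.annihilator A M < Module.annihilator A N :=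
  lt_of_le_of_ne (LinearMap.annihilator_le_of_injective f hf)
    fun h => hc (h ▸ Module.mem_annihilator.2 hN)

lemma ann_lt_of_surjective {M N : Type} [AddCommGroup M] [Module A M] [AddCommGroup N] [Module A N]
    (f : M →ₗ[A] N) (hf : Function.Surjective f) (c : A) (hc : c ∉ Module.annihilator A M)
    (hN : ∀ m : N, c • m = 0) : Module.annihilator A M < Module.annihilator A N :=
  lt_of_le_of_ne (LinearMap.annihilator_le_of_surjective f hf)
    fun h => hc (h ▸ Module.mem_annihilator.2 hN)

/-- short exact sequence of a submodule -/
lemma exact_sub {M : Type} [AddCommGroup M] [Module A M] (P : Submodule A M) :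
    Function.Exact P.subtype P.mkQ := LinearMap.exact_subtype_mkQ P

lemma exact_ker {M N : Type} [AddCommGroup M] [Module A M] [AddCommGroup N] [Module A N]
    (f : M →ₗ[A] N) : Function.Exact (LinearMap.ker f).subtype f.rangeRestrict := by
  intro m
  constructor
  · intro h
    exact ⟨⟨m, congrArg Subtype.val h⟩, rfl⟩
  · rintro ⟨⟨m, hm⟩, rfl⟩
    exact Subtype.ext hm

lemma EF.step {M : Type} [AddCommGroup M] [Module A M] (x : A) (hx : x ∈ 𝔞) (P : Submodule A M)
    (h0 : EF 𝔞 0 M) (hK : ∀ i, EF 𝔞 i (LinearMap.ker (LinearMap.lsmul A P x)))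
    (hQ : ∀ i, EF 𝔞 i (P ⧸ LinearMap.range (LinearMap.lsmul A P x)))
    (hR : ∀ i, EF 𝔞 i (M ⧸ P)) (i : ℕ) : EF 𝔞 i M := by
  cases i with
  | zero => exact h0
  | succ i =>
    exact EF.mid 𝔞 P.subtype P.mkQ P.injective_subtype (exact_sub P) P.mkQ_surjective
      (EF.of_smul 𝔞 x hx (hK _) (hQ _)) (hR _)

lemma EF.of_artin (I : Ideal A) : ∀ (M : Type) [AddCommGroup M] [Module A M],
    Module.annihilator A M = I → EF 𝔞 0 M → IsArtinian A M → ∀ i, EF 𝔞 i M := by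
  induction I using WellFoundedGT.induction with
  | ind I ih =>
  intro M _ _ hI h0 hart
  by_cases hrad : 𝔞 ≤ (Module.annihilator A M).radical
  · exact EF.of_finite 𝔞 (finite_of_rad 𝔞 M h0 hrad)
  obtain ⟨x, hx, hxr⟩ := Set.not_subset.1 hrad
  have hxn : ∀ n, x ^ n ∉ Module.annihilator A M := fun n hn => hxr ⟨n, hn⟩
  obtain ⟨n, hn⟩ := IsArtinian.monotone_stabilizes (R := A) (M := M)
    ⟨fun n => OrderDual.toDual (LinearMap.range (LinearMap.lsmul A M (x ^ n))), by
      intro i j hij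
      change LinearMap.range (LinearMap.lsmul A M (x ^ j)) ≤ LinearMap.range (LinearMap.lsmul A M (x ^ i))
      rintro _ ⟨m, rfl⟩
      refine ⟨x ^ (j - i) • m, ?_⟩
      simp only [LinearMap.lsmul_apply]
      rw [← mul_smul, ← pow_add, Nat.add_sub_cancel' hij]⟩
  have hn1 : LinearMap.range (LinearMap.lsmul A M (x ^ n)) =
    LinearMap.range (LinearMap.lsmul A M (x ^ (n + 1))) := hn (n + 1) (Nat.le_succ n)
  let P := LinearMap.range (LinearMap.lsmul A M (x ^ n))
  have hP0 : EF 𝔞 0 P := EF.zero_of_injective 𝔞 P.subtype P.injective_subtype h0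
  have hK : ∀ i, EF 𝔞 i (LinearMap.ker (LinearMap.lsmul A P x)) := by
    refine ih _ ?_ _ rfl (EF.zero_of_injective 𝔞 (Submodule.subtype _)
      (Submodule.injective_subtype _) hP0) inferInstance
    rw [← hI]
    refine ann_lt_of_injective (P.subtype ∘ₗ Submodule.subtype _)
      (P.injective_subtype.comp (Submodule.injective_subtype _)) x (by simpa using hxn 1) ?_
    rintro ⟨m, hm⟩
    exact Subtype.ext hm
  have hQ : ∀ i, EF 𝔞 i (P ⧸ LinearMap.range (LinearMap.lsmul A P x)) := by
    have : LinearMap.range (LinearMap.lsmul A P x) = ⊤ := by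
      rw [eq_top_iff]
      rintro ⟨m, hm⟩ -
      have hm' := hm
      change m ∈ LinearMap.range (LinearMap.lsmul A M (x ^ n)) at hm'
      rw [hn1] at hm'
      obtain ⟨w, hw⟩ := hm'
      refine ⟨⟨x ^ n • w, w, rfl⟩, Subtype.ext ?_⟩
      change x • x ^ n • w = m
      rw [← hw, ← mul_smul, ← pow_succ']
      rfl
    have : Subsingleton (P ⧸ LinearMap.range (LinearMap.lsmul A P x)) :=
      Submodule.Quotient.subsingleton_iff.2 this
    exact EF.of_finite 𝔞 inferInstance
  have hP : ∀ i, EF 𝔞 (i + 1) P := fun i => EF.of_smul 𝔞 x hx (hK _) (hQ _)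
  have hR : ∀ i, EF 𝔞 i (M ⧸ P) := by
    refine ih _ ?_ _ rfl (EF.right 𝔞 P.subtype P.mkQ P.injective_subtype (exact_sub P)
      P.mkQ_surjective h0 (hP 0)) inferInstance
    rw [← hI]
    refine ann_lt_of_surjective P.mkQ P.mkQ_surjective (x ^ n) (hxn n) ?_
    intro m
    obtain ⟨m, rfl⟩ := P.mkQ_surjective m
    rw [← map_smul, Submodule.mkQ_apply, Submodule.Quotient.mk_eq_zero]
    exact ⟨m, rfl⟩
  exact EF.step 𝔞 x hx P h0 hK hQ hR

lemma EF.of_support_max (M : Type) [AddCommGroup M] [Module A M] (hT : Tors 𝔞 M) (h0 : EF 𝔞 0 M)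
    (hs : ∀ p ∈ Module.support A M, p.asIdeal.IsMaximal) (i : ℕ) : EF 𝔞 i M := by
  obtain ⟨s, hsp⟩ : 𝔞.FG := IsNoetherian.noetherian 𝔞
  have hsp' : 𝔞 = Ideal.span (s : Set A) := hsp.symm
  refine EF.of_artin 𝔞 _ M rfl h0 ?_ i
  refine artin_finset s M (fun x hx m => hT x (hsp ▸ Submodule.subset_span hx) m) ?_
  have hf := (EF_zero_iff 𝔞 M).1 h0
  have he : Submodule.torsionBySet A M (s : Set A) = Submodule.torsionBySet A M (𝔞 : Set A) := by
    rw [Submodule.torsionBySet_eq_torsionBySet_span, ← hsp']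
  rw [he]
  refine artin_of_support fun p hp => hs p ?_
  exact Module.support_subset_of_injective (Submodule.subtype _) (Submodule.injective_subtype _) hp

end P3a

section P3b
variable [IsNoetherianRing A] (𝔞 : Ideal A)

lemma local_artin (p : Ideal A) [p.IsPrime] (hp : p ∈ 𝔞.minimalPrimes)
    (M : Type) [AddCommGroup M] [Module A M] (hT : Tors 𝔞 M) (h0 : EF 𝔞 0 M) :
    IsArtinian (Localization.AtPrime p) (LocalizedModule p.primeCompl M) := by
  classical
  obtain ⟨s, hsp⟩ : 𝔞.FG := IsNoetherian.noetherian 𝔞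
  have hsp' : 𝔞 = Ideal.span (s : Set A) := hsp.symm
  have hs : ∀ y ∈ s, y ∈ 𝔞 := fun y hy => hsp ▸ Submodule.subset_span hy
  set R := Localization.AtPrime p with hR
  set L := LocalizedModule p.primeCompl M with hL
  have : IsNoetherianRing R := IsLocalization.isNoetherianRing p.primeCompl R inferInstance
  refine artin_finset (s.image (algebraMap A R)) L ?_ ?_
  · intro y' hy' m
    obtain ⟨y, hy, rfl⟩ := Finset.mem_image.1 hy'
    induction m using LocalizedModule.induction_on with
    | _ m t =>
    obtain ⟨n, hn⟩ := hT y (hs y hy) m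
    refine ⟨n, ?_⟩
    rw [← map_pow, algebraMap_smul, LocalizedModule.smul'_mk, hn, LocalizedModule.zero_mk]
  let T := Submodule.torsionBySet R L ((s.image (algebraMap A R) : Finset R) : Set R)
  let F := Submodule.torsionBySet A M (𝔞 : Set A)
  have hF : F.FG := Module.Finite.iff_fg.1 ((EF_zero_iff 𝔞 M).1 h0)
  have hFL := Submodule.localized'_fg R p.primeCompl (LocalizedModule.mkLinearMap p.primeCompl M) hF
  have hTF : T ≤ F.localized' R p.primeCompl (LocalizedModule.mkLinearMap p.primeCompl M) := by
    intro m hm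
    induction m using LocalizedModule.induction_on with
    | _ m t =>
    have h1 : ∀ y : s, ∃ r : p.primeCompl, r • y.1 • m = 0 := by
      intro y
      have := (Submodule.mem_torsionBySet_iff _ _).1 hm
        ⟨algebraMap A R y.1, Finset.mem_image_of_mem _ y.2⟩
      change algebraMap A R y.1 • LocalizedModule.mk m t = 0 at this
      rw [algebraMap_smul, LocalizedModule.smul'_mk, ← LocalizedModule.zero_mk 1,
        LocalizedModule.mk_eq] at this
      obtain ⟨u, hu⟩ := this
      exact ⟨u, by simpa using hu⟩
    choose r hr using h1
    let ρ := ∏ y, r y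
    have hρ : ρ • m ∈ F := by
      change _ ∈ Submodule.torsionBySet A M (𝔞 : Set A)
      rw [hsp', ← Submodule.torsionBySet_eq_torsionBySet_span, Submodule.mem_torsionBySet_iff]
      intro y
      have : ρ = (∏ z ∈ Finset.univ.erase y, r z) * r y :=
        (Finset.prod_erase_mul _ _ (Finset.mem_univ _)).symm
      change y.1 • ρ • m = 0
      rw [smul_comm, this, mul_smul, hr, smul_zero]
    rw [Submodule.mem_localized']
    refine ⟨ρ • m, hρ, ρ * t, ?_⟩
    rw [← IsLocalizedModule.mk_eq_mk', LocalizedModule.mk_cancel_common_left]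
  have hTfin : Module.Finite R T := by
    have : Module.Finite R (F.localized' R p.primeCompl (LocalizedModule.mkLinearMap p.primeCompl M)) :=
      Module.Finite.iff_fg.2 hFL
    exact Module.Finite.of_injective (Submodule.inclusion hTF) (Submodule.inclusion_injective hTF)
  change IsArtinian R T
  refine artin_of_support fun q hq => ?_
  obtain ⟨m, hm⟩ := Module.mem_support_iff_exists_annihilator.1 hq
  have hqs : 𝔞 ≤ q.asIdeal.comap (algebraMap A R) := by
    rw [hsp', Ideal.span_le]
    intro y hy
    refine hm ((Submodule.mem_annihilator_span_singleton m _).2 ?_)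
    exact Subtype.ext ((Submodule.mem_torsionBySet_iff _ _).1 m.2
        ⟨algebraMap A R y, Finset.mem_image_of_mem _ hy⟩)
  have hle : q.asIdeal ≤ IsLocalRing.maximalIdeal R := IsLocalRing.le_maximalIdeal q.2.ne_top
  have hmp : (IsLocalRing.maximalIdeal R).comap (algebraMap A R) = p :=
    IsLocalization.AtPrime.under_maximalIdeal R p
  have hqp : q.asIdeal.comap (algebraMap A R) ≤ p :=
    (Ideal.comap_mono hle).trans hmp.le
  have hpq : p ≤ q.asIdeal.comap (algebraMap A R) :=
    hp.2 ⟨Ideal.comap_isPrime _ _, hqs⟩ hqp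
  have : q.asIdeal = IsLocalRing.maximalIdeal R := by
    rw [← IsLocalization.map_under p.primeCompl R q.asIdeal,
      ← IsLocalization.map_under p.primeCompl R (IsLocalRing.maximalIdeal R)]
    congr 1
    exact (le_antisymm hqp hpq).trans hmp.symm
  rw [this]
  infer_instance

lemma local_stab (p : Ideal A) (hp : p ∈ 𝔞.minimalPrimes)
    (M : Type) [AddCommGroup M] [Module A M] (hT : Tors 𝔞 M) (h0 : EF 𝔞 0 M) (x : A) :
    ∃ n : ℕ, ∀ k, n ≤ k → ∀ m : M, ∃ r, r ∉ p ∧ ∃ w : M, r • x ^ k • m = x ^ (k + 1) • w := by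
  have hpp : p.IsPrime := hp.1.1
  have hart := local_artin 𝔞 p hp M hT h0
  set R := Localization.AtPrime p with hR
  set L := LocalizedModule p.primeCompl M with hL
  let ξ := algebraMap A R x
  obtain ⟨n, hn⟩ := IsArtinian.monotone_stabilizes (R := R) (M := L)
    ⟨fun n => OrderDual.toDual (LinearMap.range (LinearMap.lsmul R L (ξ ^ n))), by
      intro i j hij
      change LinearMap.range (LinearMap.lsmul R L (ξ ^ j)) ≤ LinearMap.range (LinearMap.lsmul R L (ξ ^ i))
      rintro _ ⟨m, rfl⟩
      refine ⟨ξ ^ (j - i) • m, ?_⟩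
      simp only [LinearMap.lsmul_apply]
      rw [← mul_smul, ← pow_add, Nat.add_sub_cancel' hij]⟩
  refine ⟨n, fun k hk m => ?_⟩
  have hn1 : LinearMap.range (LinearMap.lsmul R L (ξ ^ k)) =
    LinearMap.range (LinearMap.lsmul R L (ξ ^ (k + 1))) := (hn k hk).symm.trans (hn (k + 1) (by omega))
  have : ξ ^ k • (LocalizedModule.mk m 1 : L) ∈ LinearMap.range (LinearMap.lsmul R L (ξ ^ (k + 1))) :=
    hn1 ▸ ⟨_, rfl⟩
  obtain ⟨w, hw⟩ := this
  induction w using LocalizedModule.induction_on with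
  | _ w t =>
  change ξ ^ (k + 1) • (LocalizedModule.mk w t : L) = _ at hw
  rw [← map_pow, ← map_pow, algebraMap_smul, algebraMap_smul, LocalizedModule.smul'_mk,
    LocalizedModule.smul'_mk, LocalizedModule.mk_eq] at hw
  obtain ⟨u, hu⟩ := hw
  rw [one_smul] at hu
  refine ⟨u.1 * t.1, (u * t).2, u.1 • w, ?_⟩
  rw [mul_smul, smul_comm _ u.1 w]
  exact hu.symm

lemma global_stab (M : Type) [AddCommGroup M] [Module A M] (hT : Tors 𝔞 M) (h0 : EF 𝔞 0 M) (x : A) :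
    ∃ n : ℕ, ∀ p ∈ 𝔞.minimalPrimes, ∀ m : M, ∃ r, r ∉ p ∧ ∃ w : M,
      r • x ^ n • m = x ^ (n + 1) • w := by
  have hfin := 𝔞.finite_minimalPrimes_of_isNoetherianRing A
  choose n hn using fun p : 𝔞.minimalPrimes => local_stab 𝔞 p.1 p.2 M hT h0 x
  have : Fintype 𝔞.minimalPrimes := hfin.fintype
  refine ⟨∑ p, n p, fun p hp m => hn ⟨p, hp⟩ _ ?_ m⟩
  exact Finset.single_le_sum (f := n) (fun _ _ => Nat.zero_le _) (Finset.mem_univ _)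

lemma EF.criterion (hd : ∀ p : Ideal A, p.IsPrime → 𝔞 ≤ p → p ∉ 𝔞.minimalPrimes → p.IsMaximal)
    (I : Ideal A) : ∀ (M : Type) [AddCommGroup M] [Module A M],
    Module.annihilator A M = I → Tors 𝔞 M → EF 𝔞 0 M → EF 𝔞 1 M → ∀ i, EF 𝔞 i M := by
  induction I using WellFoundedGT.induction with
  | ind I ih =>
  intro M _ _ hI hT h0 h1
  by_cases hrad : 𝔞 ≤ (Module.annihilator A M).radical
  · exact EF.of_finite 𝔞 (finite_of_rad 𝔞 M h0 hrad)
  obtain ⟨x, hx, hxr⟩ := Set.not_subset.1 hrad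
  have hxn : ∀ n, x ^ n ∉ Module.annihilator A M := fun n hn => hxr ⟨n, hn⟩
  obtain ⟨n, hn⟩ := global_stab 𝔞 M hT h0 x
  let P := LinearMap.range (LinearMap.lsmul A M (x ^ n))
  have hP0 : EF 𝔞 0 P := EF.zero_of_injective 𝔞 P.subtype P.injective_subtype h0
  have hPT : Tors 𝔞 P := Tors.of_injective P.subtype P.injective_subtype hT
  have hKn : ∀ i, EF 𝔞 i (LinearMap.ker (LinearMap.lsmul A M (x ^ n))) := by
    refine ih _ ?_ _ rfl (Tors.of_injective (Submodule.subtype _) (Submodule.injective_subtype _) hT)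
      (EF.zero_of_injective 𝔞 (Submodule.subtype _) (Submodule.injective_subtype _) h0)
      (EF.left 𝔞 _ _ (Submodule.injective_subtype _) (exact_ker _)
        (LinearMap.surjective_rangeRestrict _) hP0 h1)
    rw [← hI]
    refine ann_lt_of_injective (Submodule.subtype _) (Submodule.injective_subtype _) (x ^ n) (hxn n) ?_
    rintro ⟨m, hm⟩
    exact Subtype.ext hm
  have hP1 : EF 𝔞 1 P := EF.right 𝔞 _ _ (Submodule.injective_subtype _) (exact_ker _)
        (LinearMap.surjective_rangeRestrict _) h1 (hKn 2)
  let P' := LinearMap.range (LinearMap.lsmul A P x)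
  have hP'0 : EF 𝔞 0 P' := EF.zero_of_injective 𝔞 P'.subtype P'.injective_subtype hP0
  have hK : ∀ i, EF 𝔞 i (LinearMap.ker (LinearMap.lsmul A P x)) := by
    refine ih _ ?_ _ rfl (Tors.of_injective (Submodule.subtype _) (Submodule.injective_subtype _) hPT)
      (EF.zero_of_injective 𝔞 (Submodule.subtype _) (Submodule.injective_subtype _) hP0)
      (EF.left 𝔞 _ _ (Submodule.injective_subtype _) (exact_ker _)
        (LinearMap.surjective_rangeRestrict _) hP'0 hP1)
    rw [← hI]
    refine ann_lt_of_injective (P.subtype ∘ₗ Submodule.subtype _)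
      (P.injective_subtype.comp (Submodule.injective_subtype _)) x (by simpa using hxn 1) ?_
    rintro ⟨m, hm⟩
    exact Subtype.ext hm
  have hP'1 : EF 𝔞 1 P' := EF.right 𝔞 _ _ (Submodule.injective_subtype _) (exact_ker _)
        (LinearMap.surjective_rangeRestrict _) hP1 (hK 2)
  have hQT : Tors 𝔞 (P ⧸ P') := Tors.of_surjective P'.mkQ P'.mkQ_surjective hPT
  have hQ : ∀ i, EF 𝔞 i (P ⧸ P') := by
    refine EF.of_support_max 𝔞 _ hQT (EF.right 𝔞 _ _ P'.injective_subtype (exact_sub P')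
      P'.mkQ_surjective hP0 hP'1) ?_
    intro p hp
    refine hd p.asIdeal p.2 ((tors_iff 𝔞).2 hQT hp) fun hmin => ?_
    refine (Module.notMem_support_iff'.2 ?_) hp
    intro q
    obtain ⟨⟨_, m, rfl⟩, rfl⟩ := P'.mkQ_surjective q
    obtain ⟨r, hr, w, hw⟩ := hn _ hmin m
    refine ⟨r, hr, ?_⟩
    rw [← map_smul, Submodule.mkQ_apply, Submodule.Quotient.mk_eq_zero]
    refine ⟨⟨x ^ n • w, w, rfl⟩, Subtype.ext ?_⟩
    change x • x ^ n • w = r • x ^ n • m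
    rw [hw, ← mul_smul, ← pow_succ']
  have hP : ∀ i, EF 𝔞 (i + 1) P := fun i => EF.of_smul 𝔞 x hx (hK _) (hQ _)
  have hR : ∀ i, EF 𝔞 i (M ⧸ P) := by
    refine ih _ ?_ _ rfl (Tors.of_surjective P.mkQ P.mkQ_surjective hT)
      (EF.right 𝔞 P.subtype P.mkQ P.injective_subtype (exact_sub P) P.mkQ_surjective h0 (hP 0))
      (EF.right 𝔞 P.subtype P.mkQ P.injective_subtype (exact_sub P) P.mkQ_surjective h1 (hP 1))
    rw [← hI]
    refine ann_lt_of_surjective P.mkQ P.mkQ_surjective (x ^ n) (hxn n) ?_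
    intro m
    obtain ⟨m, rfl⟩ := P.mkQ_surjective m
    rw [← map_smul, Submodule.mkQ_apply, Submodule.Quotient.mk_eq_zero]
    exact ⟨m, rfl⟩
  exact EF.step 𝔞 x hx P h0 hK hQ hR

end P3b

section P4
set_option linter.unusedSectionVars false
variable [IsNoetherianRing A] (𝔞 : Ideal A)

lemma dim_cond {t : ℕ} (x : Fin t → A) (hx : ∀ j, x j ∈ 𝔞)
    (hdim : ringKrullDim (A ⧸ Ideal.span (Set.range x)) ≤ 1) :
    ∀ p : Ideal A, p.IsPrime → 𝔞 ≤ p → p ∉ 𝔞.minimalPrimes → p.IsMaximal := by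
  intro p hp hap hmin
  let J := Ideal.span (Set.range x)
  have hJ : J ≤ 𝔞 := Ideal.span_le.2 (by rintro _ ⟨j, rfl⟩; exact hx j)
  have hk : Ring.KrullDimLE 1 (A ⧸ J) := (Order.krullDimLE_iff _ _).2 hdim
  rw [Ring.krullDimLE_one_iff] at hk
  obtain ⟨q, hq, hqp⟩ := Ideal.exists_minimalPrimes_le hap
  have hqp' : ¬ p ≤ q := fun h => hmin (le_antisymm hqp h ▸ hq)
  have hmapp : ∀ r : Ideal A, r.IsPrime → J ≤ r → (r.map (Ideal.Quotient.mk J)).IsPrime := by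
    intro r hr hJr
    exact Ideal.map_isPrime_of_surjective Ideal.Quotient.mk_surjective (by rwa [Ideal.mk_ker])
  have hcm : ∀ r : Ideal A, J ≤ r → (r.map (Ideal.Quotient.mk J)).comap (Ideal.Quotient.mk J) = r := by
    intro r hJr
    rw [Ideal.comap_map_of_surjective _ Ideal.Quotient.mk_surjective, ← RingHom.ker_eq_comap_bot,
      Ideal.mk_ker, sup_eq_left.2 hJr]
  rcases hk _ (hmapp p hp (hJ.trans hap)) with h | h
  · exfalso
    have h1 : p.map (Ideal.Quotient.mk J) ≤ q.map (Ideal.Quotient.mk J) :=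
      h.2 ⟨hmapp q hq.1.1 (hJ.trans hq.1.2), bot_le⟩ (Ideal.map_mono hqp)
    have h2 := Ideal.comap_mono (f := Ideal.Quotient.mk J) h1
    rw [hcm p (hJ.trans hap), hcm q (hJ.trans hq.1.2)] at h2
    exact hqp' h2
  · have := Ideal.comap_isMaximal_of_surjective (Ideal.Quotient.mk J) Ideal.Quotient.mk_surjective
      (H := h)
    rwa [hcm p (hJ.trans hap)] at this

section kos
variable {t : ℕ} (x : Fin t → A) (M : Type) [AddCommGroup M] [Module A M]

lemma koszulD_apply (i : ℕ) (C : Finset (Fin t) → M) (y : KoszulCochain x M i)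
    (hy : ∀ s, y s = C s.1) (s : {s : Finset (Fin t) // s.card = i + 1}) :
    koszulD x M i y s =
      ∑ j ∈ s.1, (((-1 : A) ^ ((s.1.filter (fun k => k < j)).card)) * x j) • C (s.1.erase j) := by
  rw [← Finset.sum_attach]
  simp only [koszulD, LinearMap.pi_apply, LinearMap.sum_apply, LinearMap.smul_apply,
    LinearMap.proj_apply, hy]

def kosC (s : Finset (Fin t)) : A :=
  ∑ j ∈ s, (((-1 : A) ^ ((s.filter (fun k => k < j)).card)) * x j)

lemma kosC_mem (hx : ∀ j, x j ∈ 𝔞) (s : Finset (Fin t)) : kosC x s ∈ 𝔞 :=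
  Ideal.sum_mem _ fun j _ => Ideal.mul_mem_left _ _ (hx j)

lemma koszulD_zero (y : KoszulCochain x M 0) (s : {s : Finset (Fin t) // s.card = 0 + 1}) :
    koszulD x M 0 y s = kosC x s.1 • y ⟨∅, rfl⟩ := by
  rw [koszulD_apply x M 0 (fun _ => y ⟨∅, rfl⟩) y, kosC, Finset.sum_smul]
  rintro ⟨s, hs⟩
  rw [Finset.card_eq_zero] at hs
  subst hs
  rfl

lemma koszulD_pair (m : M) (y : KoszulCochain x M 1)
    (hy : ∀ s, y s = kosC x s.1 • m) (s : {s : Finset (Fin t) // s.card = 1 + 1})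
    (a b : Fin t) (hab : a < b) (hs : s.1 = {a, b}) : koszulD x M 1 y s = 0 := by
  rw [koszulD_apply x M 1 (fun s => kosC x s • m) y hy, hs, Finset.sum_pair hab.ne]
  have e1 : ({a, b} : Finset (Fin t)).erase a = {b} := by
    rw [Finset.erase_insert]; simpa using hab.ne
  have e2 : ({a, b} : Finset (Fin t)).erase b = {a} := by
    rw [Finset.pair_comm, Finset.erase_insert]; simpa using hab.ne'
  have f1 : ({a, b} : Finset (Fin t)).filter (fun k => k < a) = ∅ := by
    ext k; simp; rintro (rfl | rfl); exacts [le_rfl, hab.le]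
  have f2 : ({a, b} : Finset (Fin t)).filter (fun k => k < b) = {a} := by
    ext k; simp; constructor
    · rintro ⟨rfl | rfl, h⟩
      · rfl
      · exact absurd h (lt_irrefl _)
    · rintro rfl; exact ⟨Or.inl rfl, hab⟩
  rw [e1, e2, f1, f2]
  simp only [kosC, Finset.sum_singleton, Finset.filter_singleton, lt_irrefl, if_false,
    Finset.card_empty, Finset.card_singleton, pow_zero, pow_one, one_mul]
  rw [← mul_smul, ← mul_smul, ← add_smul]
  convert zero_smul A m using 2
  ring

lemma koszulD_comp (y : KoszulCochain x M 0) : koszulD x M 1 (koszulD x M 0 y) = 0 := by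
  funext s
  obtain ⟨a, b, hab, hs⟩ := Finset.card_eq_two.1 s.2
  rcases lt_or_gt_of_ne hab with h | h
  · exact koszulD_pair x M _ _ (koszulD_zero x M y) s a b h hs
  · exact koszulD_pair x M _ _ (koszulD_zero x M y) s b a h (by rw [hs, Finset.pair_comm])

lemma EF_of_koszul (hx : ∀ j, x j ∈ 𝔞) (h0 : ∀ i, EF 𝔞 i (KoszulCohomology x M 0))
    (h1 : EF 𝔞 0 (KoszulCohomology x M 1)) : EF 𝔞 0 M ∧ EF 𝔞 1 M := by
  let u : Unique {s : Finset (Fin t) // s.card = 0} :=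
    ⟨⟨⟨∅, rfl⟩⟩, fun s => Subtype.ext (Finset.card_eq_zero.1 s.2)⟩
  let e : M ≃ₗ[A] KoszulCochain x M 0 := (LinearEquiv.funUnique _ A M).symm
  let d : M →ₗ[A] KoszulCochain x M 1 := koszulD x M 0 ∘ₗ e.toLinearMap
  have hd : ∀ m s, d m s = kosC x s.1 • m := fun m s => koszulD_zero x M (e m) s
  have hker : ∀ i, EF 𝔞 i (LinearMap.ker d) := by
    intro i
    have hb : (koszulBoundary x M 0).comap (LinearMap.ker (koszulD x M 0)).subtype = ⊥ := by
      rw [koszulBoundary, ← Submodule.ker_subtype (LinearMap.ker (koszulD x M 0))]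
      rfl
    have hk : EF 𝔞 i (LinearMap.ker (koszulD x M 0)) :=
      EF.equiv 𝔞 (Submodule.quotEquivOfEqBot _ hb) (h0 i)
    refine EF.equiv 𝔞 (LinearEquiv.ofSubmodules e (LinearMap.ker d) _ ?_).symm hk
    rw [LinearMap.ker_comp]
    exact Submodule.map_comap_eq_of_surjective e.surjective _
  have hM0 : EF 𝔞 0 M := by
    have hf := (EF_zero_iff 𝔞 _).1 (hker 0)
    rw [EF_zero_iff]
    let φ : Submodule.torsionBySet A M (𝔞 : Set A) →ₗ[A] LinearMap.ker d :=
      LinearMap.codRestrict _ (Submodule.subtype _) (by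
        rintro ⟨m, hm⟩
        rw [LinearMap.mem_ker]
        funext s
        rw [hd]
        exact (Submodule.mem_torsionBySet_iff _ _).1 hm ⟨_, kosC_mem 𝔞 x hx s.1⟩)
    let ψ : Submodule.torsionBySet A M (𝔞 : Set A) →ₗ[A]
        Submodule.torsionBySet A (LinearMap.ker d) (𝔞 : Set A) :=
      LinearMap.codRestrict _ φ (by
        rintro ⟨m, hm⟩
        rw [Submodule.mem_torsionBySet_iff]
        intro a
        exact Subtype.ext ((Submodule.mem_torsionBySet_iff _ _).1 hm a))
    refine Module.Finite.of_injective ψ ?_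
    intro a b hab
    exact Subtype.ext (congrArg (fun z : Submodule.torsionBySet A (LinearMap.ker d) (𝔞 : Set A) =>
      (z.1.1 : M)) hab)
  refine ⟨hM0, EF.of_smul_map 𝔞 (fun s : {s : Finset (Fin t) // s.card = 1} => kosC x s.1)
    (fun s => kosC_mem 𝔞 x hx s.1) d hd (hker 1) ?_⟩
  have hr : LinearMap.range d = koszulBoundary x M 1 := LinearEquiv.range_comp e (koszulD x M 0)
  refine EF.equiv 𝔞 (Submodule.quotEquivOfEq _ _ hr.symm) ?_
  let v : (KoszulCochain x M 1 ⧸ koszulBoundary x M 1) →ₗ[A] KoszulCochain x M 2 :=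
    Submodule.liftQ _ (koszulD x M 1) (by
      rintro _ ⟨y, rfl⟩
      exact koszulD_comp x M y)
  let w : KoszulCohomology x M 1 →ₗ[A] (KoszulCochain x M 1 ⧸ koszulBoundary x M 1) :=
    Submodule.mapQ _ _ (Submodule.subtype _) le_rfl
  have hw : Function.Injective w := by
    rw [injective_iff_map_eq_zero]
    intro z hz
    obtain ⟨y, rfl⟩ := Submodule.mkQ_surjective _ z
    have hz' : Submodule.Quotient.mk y.1 = (0 : KoszulCochain x M 1 ⧸ koszulBoundary x M 1) := hz
    rw [Submodule.Quotient.mk_eq_zero] at hz'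
    rw [Submodule.mkQ_apply, Submodule.Quotient.mk_eq_zero]
    exact hz'
  have hK2 : EF 𝔞 0 (KoszulCochain x M 2) := EF.pi 𝔞 hM0
  refine EF.mid 𝔞 w v.rangeRestrict hw ?_ (LinearMap.surjective_rangeRestrict _) h1
    (EF.zero_of_injective 𝔞 (Submodule.subtype _) (Submodule.injective_subtype _) hK2)
  intro q
  constructor
  · intro h
    obtain ⟨y, rfl⟩ := Submodule.mkQ_surjective _ q
    have hy : koszulD x M 1 y = 0 := congrArg Subtype.val h
    exact ⟨Submodule.Quotient.mk ⟨y, hy⟩, rfl⟩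
  · rintro ⟨z, rfl⟩
    obtain ⟨⟨y, hy⟩, rfl⟩ := Submodule.mkQ_surjective _ z
    exact Subtype.ext hy
end kos

lemma EF.abel (hd : ∀ p : Ideal A, p.IsPrime → 𝔞 ≤ p → p ∉ 𝔞.minimalPrimes → p.IsMaximal)
    {M N : Type} [AddCommGroup M] [Module A M] [AddCommGroup N] [Module A N] (f : M →ₗ[A] N)
    (hT : Tors 𝔞 M) (hM : ∀ i, EF 𝔞 i M) (hN : ∀ i, EF 𝔞 i N) :
    (∀ i, EF 𝔞 i (LinearMap.ker f)) ∧ (∀ i, EF 𝔞 i (LinearMap.range f)) ∧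
      (∀ i, EF 𝔞 i (N ⧸ LinearMap.range f)) := by
  have hK : ∀ i, EF 𝔞 i (LinearMap.ker f) :=
    EF.criterion 𝔞 hd _ _ rfl
      (Tors.of_injective (Submodule.subtype _) (Submodule.injective_subtype _) hT)
      (EF.zero_of_injective 𝔞 (Submodule.subtype _) (Submodule.injective_subtype _) (hM 0))
      (EF.left 𝔞 _ _ (Submodule.injective_subtype _) (exact_ker _)
        (LinearMap.surjective_rangeRestrict _)
        (EF.zero_of_injective 𝔞 (Submodule.subtype _) (Submodule.injective_subtype _) (hN 0)) (hM 1))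
  have hR : ∀ i, EF 𝔞 i (LinearMap.range f) := fun i =>
    EF.right 𝔞 _ _ (Submodule.injective_subtype _) (exact_ker _)
        (LinearMap.surjective_rangeRestrict _) (hM i) (hK _)
  exact ⟨hK, hR, fun i => EF.right 𝔞 _ _ (Submodule.injective_subtype _) (exact_sub _)
    (Submodule.mkQ_surjective _) (hN i) (hR _)⟩

lemma koszul_cofinite
    (hd : ∀ p : Ideal A, p.IsPrime → 𝔞 ≤ p → p ∉ 𝔞.minimalPrimes → p.IsMaximal)
    {t : ℕ} (x : Fin t → A) (M : Type) [AddCommGroup M] [Module A M]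
    (hT : Tors 𝔞 M) (hM : ∀ i, EF 𝔞 i M) (i : ℕ) : IsCofinite 𝔞 (KoszulCohomology x M i) := by
  have hC : ∀ k i, EF 𝔞 i (KoszulCochain x M k) := fun k i => EF.pi 𝔞 (hM i)
  have hCT : ∀ k, Tors 𝔞 (KoszulCochain x M k) := fun k => Tors.pi hT
  have hab := fun k => EF.abel 𝔞 hd (koszulD x M k) (hCT k) (hC k) (hC (k + 1))
  have hZT : Tors 𝔞 (LinearMap.ker (koszulD x M i)) :=
    Tors.of_injective (Submodule.subtype _) (Submodule.injective_subtype _) (hCT i)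
  have hB : ∀ j, EF 𝔞 j (koszulBoundary x M i) := by
    cases i with
    | zero => exact EF.of_finite 𝔞 (inferInstanceAs (Module.Finite A (⊥ : Submodule A _)))
    | succ i => exact (hab i).2.1
  rw [isCofinite_iff]
  refine ⟨(tors_iff 𝔞).2 (Tors.of_surjective (Submodule.mkQ _) (Submodule.mkQ_surjective _) hZT), ?_⟩
  intro j
  refine EF.right 𝔞 _ _ (Submodule.injective_subtype _) (exact_sub _)
    (Submodule.mkQ_surjective _) ((hab i).1 j) ?_
  have hBT : Tors 𝔞 (koszulBoundary x M i) :=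
    Tors.of_injective (Submodule.subtype _) (Submodule.injective_subtype _) (hCT i)
  have := (EF.abel 𝔞 hd (koszulD x M i ∘ₗ (koszulBoundary x M i).subtype) hBT hB (hC (i + 1))).1 (j + 1)
  refine EF.equiv 𝔞 ?_ this
  refine LinearEquiv.ofBijective (LinearMap.codRestrict _ (LinearMap.codRestrict _
    ((koszulBoundary x M i).subtype ∘ₗ Submodule.subtype _) ?_) ?_) ⟨?_, ?_⟩
  · rintro ⟨⟨y, hy⟩, hy'⟩
    exact hy'
  · rintro ⟨⟨y, hy⟩, hy'⟩
    exact hy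
  · rintro ⟨⟨y, hy⟩, hy'⟩ ⟨⟨z, hz⟩, hz'⟩ h
    have : y = z := congrArg (fun q => (q.1.1 : KoszulCochain x M i)) h
    subst this
    rfl
  · rintro ⟨⟨y, hy⟩, hy'⟩
    exact ⟨⟨⟨y, hy'⟩, hy⟩, rfl⟩
end P4

/-- If `x₁, …, x_t ∈ 𝔞` with `dim A/(x) ≤ 1` and `f : M ⟶ N` is a homomorphism between
`𝔞`-torsion modules all of whose Koszul cohomologies are `𝔞`-cofinite, then the kernel
and cokernel of `f` are `𝔞`-torsion and all their Koszul cohomologies are `𝔞`-cofinite;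
that is, the category `𝒦ℳ(x,𝔞,A)_cof ∩ 𝒯(𝔞)` is abelian. -/
theorem stmt13 [IsNoetherianRing A] (𝔞 : Ideal A) {t : ℕ} (x : Fin t → A)
    (hx : ∀ j, x j ∈ 𝔞)
    (hdim : ringKrullDim (A ⧸ Ideal.span (Set.range x)) ≤ 1)
    (M N : Type) [AddCommGroup M] [Module A M] [AddCommGroup N] [Module A N]
    (hM : Module.support A M ⊆ PrimeSpectrum.zeroLocus (𝔞 : Set A))
    (hN : Module.support A N ⊆ PrimeSpectrum.zeroLocus (𝔞 : Set A))
    (hMcof : ∀ i : ℕ, IsCofinite 𝔞 (KoszulCohomology x M i))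
    (hNcof : ∀ i : ℕ, IsCofinite 𝔞 (KoszulCohomology x N i))
    (f : M →ₗ[A] N) :
    (Module.support A ↥(LinearMap.ker f) ⊆ PrimeSpectrum.zeroLocus (𝔞 : Set A)) ∧
    (Module.support A (N ⧸ LinearMap.range f) ⊆ PrimeSpectrum.zeroLocus (𝔞 : Set A)) ∧
    (∀ i : ℕ, IsCofinite 𝔞 (KoszulCohomology x ↥(LinearMap.ker f) i)) ∧
    (∀ i : ℕ, IsCofinite 𝔞 (KoszulCohomology x (N ⧸ LinearMap.range f) i)) := by
  have hd := dim_cond 𝔞 x hx hdim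
  have hMT := (tors_iff 𝔞).1 hM
  have hNT := (tors_iff 𝔞).1 hN
  have key : ∀ (M : Type) [AddCommGroup M] [Module A M], Tors 𝔞 M →
      (∀ i : ℕ, IsCofinite 𝔞 (KoszulCohomology x M i)) → ∀ i, EF 𝔞 i M := by
    intro M _ _ hT h
    have h' := EF_of_koszul 𝔞 x M hx ((isCofinite_iff 𝔞 _).1 (h 0)).2
      (((isCofinite_iff 𝔞 _).1 (h 1)).2 0)
    exact EF.criterion 𝔞 hd _ M rfl hT h'.1 h'.2
  have hab := EF.abel 𝔞 hd f hMT (key M hMT hMcof) (key N hNT hNcof)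
  have hKT : Tors 𝔞 (LinearMap.ker f) :=
    Tors.of_injective (Submodule.subtype _) (Submodule.injective_subtype _) hMT
  have hCT : Tors 𝔞 (N ⧸ LinearMap.range f) :=
    Tors.of_surjective (Submodule.mkQ _) (Submodule.mkQ_surjective _) hNT
  exact ⟨(tors_iff 𝔞).2 hKT, (tors_iff 𝔞).2 hCT,
    koszul_cofinite 𝔞 hd x _ hKT hab.1, koszul_cofinite 𝔞 hd x _ hCT hab.2.2⟩

end
end

section
/- Let A be a commutative noetherian ring, 𝔞 an ideal, and x ∈ A with dim A/xA = 1. If M and N are A-modules such that (0 :_M x), M/xM, (0 :_N x), N/xN are all 𝔞-cofinite (i.e., M, N ∈ 𝒦ℳ(x,𝔞,A)_cof), and f : M → N is any A-homomorphism, then (0 :_{Ker f} x), (Ker f)/x(Ker f), (0 :_{Coker f} x), and (Coker f)/x(Coker f) are 𝔞-cofinite. That is, the category 𝒦ℳ(x,𝔞,A)_cof is abelian. -/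
open CategoryTheory Limits

noncomputable section

variable {A : Type} [CommRing A]

section alg
variable {A : Type} [CommRing A]

lemma artinian_step {Q : Type} [AddCommGroup Q] [Module A Q] (y : A)
    (ht : ∀ m : Q, ∃ k : ℕ, y ^ k • m = 0)
    (hT : IsArtinian A (Submodule.torsionBy A Q y)) : IsArtinian A Q := by
  rw [← monotone_stabilizes_iff_artinian]
  intro f
  set T := Submodule.torsionBy A Q y
  let N : ℕ → Submodule A Q := fun i => OrderDual.ofDual (f i)
  have hN : Antitone N := fun i j h => f.monotone h
  let L : ℕ → ℕ → Submodule A T := fun i n =>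
    ((N i).map (LinearMap.lsmul A Q (y ^ n))).comap T.subtype
  have memL : ∀ i n (t : T), t ∈ L i n ↔ ∃ z ∈ N i, y ^ n • z = (t : Q) := by
    intro i n t; simp [L]
  have hL : ∀ i j n m, i ≤ j → n ≤ m → L j m ≤ L i n := by
    intro i j n m hij hnm t ht
    rw [memL] at ht ⊢
    obtain ⟨z, hz, h⟩ := ht
    refine ⟨y ^ (m - n) • z, (N i).smul_mem _ (hN hij hz), ?_⟩
    rw [smul_smul, ← pow_add, Nat.add_sub_cancel' hnm, h]
  have stab : ∀ g : ℕ → Submodule A T, Antitone g → ∃ n, ∀ m, n ≤ m → g n = g m := by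
    intro g hg
    exact (monotone_stabilizes_iff_artinian (R := A) (M := T)).2 hT
      ⟨fun i => OrderDual.toDual (g i), fun i j h => hg h⟩
  obtain ⟨n0, hn0⟩ := stab (fun i => L i i) (fun i j h => hL _ _ _ _ h h)
  choose s hs using fun n => stab (fun i => L i n) (fun i j h => hL _ _ _ _ h le_rfl)
  let I := max n0 ((Finset.range n0).sup s)
  have key : ∀ i, I ≤ i → ∀ n, L I n ≤ L i n := by
    intro i hi n
    by_cases hn : n < n0
    · have h1 : s n ≤ I := le_trans (Finset.le_sup (f := s) (Finset.mem_range.2 hn)) (le_max_right _ _)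
      have e1 := hs n I h1
      have e2 := hs n i (h1.trans hi)
      exact (e1.symm.trans e2).le
    · push Not at hn
      have h0 : n0 ≤ I := le_max_left _ _
      calc L I n ≤ L n0 n0 := hL _ _ _ _ h0 hn
        _ = L (max i n) (max i n) := hn0 _ (hn.trans (le_max_right _ _))
        _ ≤ L i n := hL _ _ _ _ (le_max_left _ _) (le_max_right _ _)
  refine ⟨I, fun i hi => ?_⟩
  have claim : ∀ n, ∀ z ∈ N I, y ^ n • z = 0 → z ∈ N i := by
    intro n
    induction n with
    | zero => intro z _ h; simp at h; simp [h]
    | succ n ih =>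
      intro z hz h
      have hmem : y ^ n • z ∈ T := by
        rw [Submodule.mem_torsionBy_iff, smul_smul, ← pow_succ', h]
      obtain ⟨z', hz', h'⟩ := (memL _ _ _).1 (key i hi n ((memL I n ⟨_, hmem⟩).2 ⟨z, hz, rfl⟩))
      have := ih (z - z') ((N I).sub_mem hz (hN hi hz')) (by rw [smul_sub, h']; simp)
      simpa using (N i).add_mem this hz'
  have : N I = N i := by
    apply le_antisymm
    · intro z hz
      obtain ⟨k, hk⟩ := ht z
      exact claim k z hz hk
    · exact hN hi
  exact this

lemma artinian_finset (s : Finset A) : ∀ {Q : Type} [AddCommGroup Q] [Module A Q]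
    (_ : ∀ a ∈ s, ∀ m : Q, ∃ k : ℕ, a ^ k • m = 0)
    (_ : IsArtinian A (Submodule.torsionBySet A Q (s : Set A))), IsArtinian A Q := by
  classical
  induction s using Finset.induction_on with
  | empty =>
    intro Q _ _ _ h
    refine isArtinian_of_injective
      (LinearMap.codRestrict (Submodule.torsionBySet A Q ((∅ : Finset A) : Set A)) LinearMap.id
        (by intro c; simp [Submodule.mem_torsionBySet_iff])) ?_
    intro a b hab
    simpa using congrArg Subtype.val hab
  | insert a s _ ih =>
    intro Q _ _ ht h
    refine artinian_step a (ht a (by simp)) (ih ?_ ?_)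
    · intro b hb m
      obtain ⟨k, hk⟩ := ht b (by simp [hb]) m
      exact ⟨k, Subtype.ext (by simpa using hk)⟩
    · refine isArtinian_of_injective
        (LinearMap.codRestrict (Submodule.torsionBySet A Q ((insert a s : Finset A) : Set A))
        ((Submodule.torsionBy A Q a).subtype ∘ₗ (Submodule.torsionBySet A _ (s : Set A)).subtype) ?_) ?_
      · rintro ⟨⟨c, hc⟩, hc'⟩
        rw [Submodule.mem_torsionBySet_iff] at hc' ⊢
        rintro ⟨b, hb⟩
        rcases Finset.mem_insert.1 (Finset.mem_coe.1 hb) with rfl | hb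
        · simpa using hc
        · have := congrArg Subtype.val (hc' ⟨b, hb⟩)
          simpa using this
      · intro u v huv
        have := congrArg Subtype.val huv
        exact Subtype.ext (Subtype.ext (by simpa using this))

variable (𝔞 : Ideal A)

lemma artinian_ideal [IsNoetherianRing A] {Q : Type} [AddCommGroup Q] [Module A Q]
    (ht : ∀ m : Q, ∃ k : ℕ, ∀ a ∈ 𝔞 ^ k, a • m = 0)
    (h : IsArtinian A (Submodule.torsionBySet A Q (𝔞 : Set A))) : IsArtinian A Q := by
  obtain ⟨s, hs⟩ := (IsNoetherian.noetherian 𝔞 : 𝔞.FG)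
  refine artinian_finset s ?_ ?_
  · intro a ha m
    obtain ⟨k, hk⟩ := ht m
    exact ⟨k, hk _ (Ideal.pow_mem_pow (hs ▸ Submodule.subset_span ha) k)⟩
  · have : Submodule.torsionBySet A Q (s : Set A) = Submodule.torsionBySet A Q (𝔞 : Set A) := by
      rw [← hs]; exact (Submodule.torsionBySet_eq_torsionBySet_span (s : Set A))
    rw [this]; exact h

lemma finite_of_artinian_killed (J : Ideal A) [IsArtinianRing (A ⧸ J)] {Q : Type} [AddCommGroup Q]
    [Module A Q] (hJ : ∀ a ∈ J, ∀ m : Q, a • m = 0) : Module.Finite A Q ↔ IsArtinian A Q := by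
  have hQ : Module.IsTorsionBySet A Q (J : Set A) := fun m a => hJ a a.2 m
  let := hQ.module
  have e := (IsArtinianRing.tfae (A ⧸ J) Q).out 0 2
  rw [hQ.semilinearMap.isArtinian_iff_of_bijective Function.bijective_id,
    hQ.semilinearMap.finite_iff_of_bijective Function.bijective_id]
  exact e
end alg

section ringpart
variable {A : Type} [CommRing A]

lemma exists_colon [IsNoetherianRing A] (𝔞 : Ideal A) (x : A)
    (hdim : ringKrullDim (A ⧸ Ideal.span {x}) = 1) :
    ∃ (n : ℕ) (c J : Ideal A), IsArtinianRing (A ⧸ J) ∧ (∀ r ∈ c, ∀ a ∈ 𝔞 ^ n, r * a ∈ Ideal.span {x}) ∧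
      J = 𝔞 ⊔ c := by
  classical
  set I := Ideal.span {x}
  have h1 : Ring.KrullDimLE 1 (A ⧸ I) := by
    rw [Ring.KrullDimLE, Order.krullDimLE_iff]; exact hdim.le
  rw [Ring.krullDimLE_one_iff] at h1
  -- the stabilised colon ideal
  let C : ℕ → Ideal A := fun n => 
    { carrier := {r | ∀ a ∈ 𝔞 ^ n, r * a ∈ I}
      add_mem' := fun {r s} hr hs a ha => by rw [add_mul]; exact I.add_mem (hr a ha) (hs a ha)
      zero_mem' := fun a _ => by simp
      smul_mem' := fun t r hr a ha => by
        rw [smul_eq_mul, mul_assoc]; exact I.mul_mem_left _ (hr a ha) }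
  have memC : ∀ n r, r ∈ C n ↔ ∀ a ∈ 𝔞 ^ n, r * a ∈ I := fun _ _ => Iff.rfl
  have hC : Monotone C := fun n m h r hr a ha => hr a (Ideal.pow_le_pow_right h ha)
  obtain ⟨n, hn⟩ := (monotone_stabilizes_iff_noetherian (R := A) (M := A)).2 inferInstance ⟨C, hC⟩
  have hCn : ∀ m, C m ≤ C n := by
    intro m
    rcases le_total n m with h | h
    · exact (hn m h).ge
    · exact hC h
  refine ⟨n, C n, 𝔞 ⊔ C n, ?_, fun r hr => hr, rfl⟩
  have : Ring.KrullDimLE 0 (A ⧸ (𝔞 ⊔ C n)) := by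
    rw [Ring.krullDimLE_zero_iff]
    intro q hq
    set p := q.comap (Ideal.Quotient.mk (𝔞 ⊔ C n)) with hp
    have hpp : p.IsPrime := Ideal.comap_isPrime _ _
    have hle : 𝔞 ⊔ C n ≤ p := by
      intro r hr
      rw [hp, Ideal.mem_comap, Ideal.Quotient.eq_zero_iff_mem.2 hr]; exact q.zero_mem
    have hIp : I ≤ p := by
      refine le_trans (fun r hr => ?_) (le_sup_right.trans hle)
      rw [memC]; intro a _; exact I.mul_mem_right _ hr
    suffices hmax : p.IsMaximal by
      have := Ideal.map_eq_top_or_isMaximal_of_surjective (Ideal.Quotient.mk (𝔞 ⊔ C n)) Ideal.Quotient.mk_surjective hmax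
      rw [hp, Ideal.map_comap_of_surjective _ Ideal.Quotient.mk_surjective] at this
      exact this.resolve_left hq.ne_top
    -- p is not minimal over I
    have hnot : p ∉ I.minimalPrimes := by
      intro hmin
      have hf := I.finite_minimalPrimes_of_isNoetherianRing A
      obtain ⟨s, hs1, hs2⟩ : ∃ s, s ∈ (hf.toFinset.erase p).inf id ∧ s ∉ p := by
        by_contra! hcon
        obtain ⟨q', hq', hle'⟩ := hpp.inf_le'.1 (show (hf.toFinset.erase p).inf id ≤ p from hcon)
        rw [Finset.mem_erase, hf.mem_toFinset] at hq'
        exact hq'.1 (le_antisymm hle' (hmin.2 hq'.2.1 hle'))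
      have hrad : Ideal.span {s} * 𝔞 ≤ I.radical := by
        rw [← I.sInf_minimalPrimes]
        refine le_sInf fun q' hq' => ?_
        by_cases h : q' = p
        · rw [h, Ideal.mul_le]
          intro u _ v hv
          exact p.mul_mem_left u (hle (Ideal.mem_sup_left hv))
        · rw [Ideal.mul_le]
          intro u hu v _
          refine q'.mul_mem_right v ((Ideal.span_singleton_le_iff_mem q').2 ?_ hu)
          have : (hf.toFinset.erase p).inf id ≤ q' := Finset.inf_le (f := id) (by simp [h, hq'])
          exact this hs1
      obtain ⟨m, hm⟩ := Ideal.exists_pow_le_of_le_radical_of_fg hrad (IsNoetherian.noetherian _)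
      have : s ^ m ∈ C m := by
        rw [memC]; intro a ha
        apply hm
        rw [mul_pow]
        exact Ideal.mul_mem_mul (Ideal.pow_mem_pow (Ideal.mem_span_singleton_self s) m) ha
      exact hs2 (hpp.mem_of_pow_mem m (hle (Ideal.mem_sup_right (hCn m this))))
    set p' := p.map (Ideal.Quotient.mk I)
    have hc : p'.comap (Ideal.Quotient.mk I) = p := Ideal.comap_map_mk hIp
    have hp'p : p'.IsPrime := Ideal.map_isPrime_of_surjective Ideal.Quotient.mk_surjective (by simpa using hIp)
    rcases h1 p' hp'p with h | h
    · exfalso; apply hnot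
      rw [Ideal.minimalPrimes_eq_comap]
      exact ⟨p', h, hc⟩
    · rw [← hc]; exact Ideal.comap_isMaximal_of_surjective _ Ideal.Quotient.mk_surjective
  exact IsNoetherianRing.isArtinianRing_of_krullDimLE_zero

end ringpart

section extpart
variable {A : Type} [CommRing A]

lemma linearYoneda_pres (Y : ModuleCat.{0} A) :
    PreservesFiniteLimits ((linearYoneda A (ModuleCat.{0} A)).obj Y) := by
  have h : PreservesLimits ((linearYoneda A (ModuleCat.{0} A)).obj Y ⋙ forget (ModuleCat.{0} A)) :=
    inferInstanceAs (PreservesLimits (yoneda.obj Y))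
  have : PreservesLimits ((linearYoneda A (ModuleCat.{0} A)).obj Y) :=
    preservesLimits_of_reflects_of_preserves _ (forget (ModuleCat.{0} A))
  infer_instance

def ext0Iso (X Y : ModuleCat.{0} A) :
    ((_root_.Ext A (ModuleCat A) 0).obj (Opposite.op X)).obj Y ≅ ModuleCat.of A (X ⟶ Y) :=
  haveI := linearYoneda_pres Y
  haveI : PreservesFiniteColimits ((linearYoneda A (ModuleCat.{0} A)).obj Y).rightOp :=
    preservesFiniteColimits_rightOp _
  ((((linearYoneda A (ModuleCat A)).obj Y).rightOp.leftDerivedZeroIsoSelf).app X).unop.symm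

lemma ext_succ_finite [IsNoetherianRing A] (X Y : ModuleCat.{0} A) (n : ℕ)
    (h : Module.Finite A (Abelian.Ext X Y (n+1))) :
    Module.Finite A (((_root_.Ext A (ModuleCat A) (n+1)).obj (Opposite.op X)).obj Y) := by
  let P := projectiveResolution X
  let K := P.complex.linearYonedaObj A Y
  let T := K.sc' n (n+1) (n+2)
  have hker : ∀ f : T.X₂, T.g.hom f = 0 → P.complex.d (n+2) (n+1) ≫ (show P.complex.X (n+1) ⟶ Y from f) = 0 :=
    fun f hf => hf
  let L : LinearMap.ker T.g.hom →ₗ[A] Abelian.Ext X Y (n+1) :=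
    { toFun := fun f => P.extMk (show P.complex.X (n+1) ⟶ Y from f.1) (n+2) rfl (hker _ f.2)
      map_add' := fun f g => (P.add_extMk _ _ _ _ (hker _ f.2) (hker _ g.2)).symm
      map_smul' := fun r f => by
        rw [RingHom.id_apply, Abelian.Ext.smul_eq_comp_mk₀, P.extMk_comp_mk₀]
        congr 1 }
  have hL : LinearMap.ker L = LinearMap.range T.moduleCatToCycles := by
    ext f
    rw [LinearMap.mem_ker, LinearMap.mem_range]
    refine (P.extMk_eq_zero_iff _ (n+2) rfl (hker _ f.2) n rfl).trans ?_
    constructor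
    · rintro ⟨g, hg⟩
      exact ⟨g, Subtype.ext hg⟩
    · rintro ⟨g, hg⟩
      exact ⟨g, congrArg Subtype.val hg⟩
  have hfin : Module.Finite A (LinearMap.ker T.g.hom ⧸ LinearMap.range T.moduleCatToCycles) := by
    rw [← hL]
    exact Module.Finite.of_injective _ (LinearMap.ker_eq_bot.1 (Submodule.ker_liftQ_eq_bot' _ L rfl))
  have e : ((_root_.Ext A (ModuleCat A) (n+1)).obj (Opposite.op X)).obj Y ≅
      T.moduleCatLeftHomologyData.H :=
    P.isoExt (n+1) Y ≪≫ K.homologyIsoSc' n (n+1) (n+2) (by simp) (by simp) ≪≫ T.moduleCatHomologyIso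
  have hfin' : Module.Finite A T.moduleCatLeftHomologyData.H := hfin
  exact Module.Finite.equiv e.toLinearEquiv.symm

lemma artinian_ext [IsNoetherianRing A] (X Y : ModuleCat.{0} A) [Module.Finite A X]
    [IsArtinian A Y] (i : ℕ) : IsArtinian A (Abelian.Ext X Y i) := by
  induction i generalizing X with
  | zero =>
    obtain ⟨k, f, hf⟩ := Module.Finite.exists_fin' A X
    have : IsArtinian A (X →ₗ[A] Y) := by
      have h1 : IsArtinian A ((Fin k → A) →ₗ[A] Y) :=
        isArtinian_of_linearEquiv (((LinearMap.lsum A (fun _ : Fin k => A) A).symm.trans (LinearEquiv.piCongrRight (fun _ => LinearMap.ringLmapEquivSelf A A Y))).symm)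
      exact isArtinian_of_injective (LinearMap.lcomp A Y f) (LinearMap.lcomp_injective_of_surjective f hf)
    exact isArtinian_of_injective (Abelian.Ext.linearEquiv₀.trans ModuleCat.homLinearEquiv).toLinearMap (LinearEquiv.injective _)
  | succ n ih =>
    obtain ⟨N, _, _, _, _, f, surjf⟩ := Module.exists_finite_presentation A X
    let exac := LinearMap.shortExact_shortComplexKer surjf
    exact isArtinian_of_surjective _ (exac.extClass.precompOfLinear A Y (add_comm 1 n))
      (precomp_extClass_surjective_of_projective_X₂ Y exac n)

lemma ext_killed_right (X Y : ModuleCat.{0} A) (r : A) (h : ∀ y : Y, r • y = 0) (i : ℕ)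
    (z : Abelian.Ext X Y i) : r • z = 0 := by
  rw [Abelian.Ext.smul_eq_comp_mk₀]
  have : r • 𝟙 Y = 0 := by ext y; exact h y
  rw [this]; simp

lemma ext_killed_left (X Y : ModuleCat.{0} A) (r : A) (h : ∀ y : X, r • y = 0) (i : ℕ)
    (z : Abelian.Ext X Y i) : r • z = 0 := by
  have : r • 𝟙 X = 0 := by ext y; exact h y
  have h2 : z = (Abelian.Ext.mk₀ (𝟙 X)).comp z (zero_add i) := by simp
  rw [h2, ← Abelian.Ext.smul_comp, ← Abelian.Ext.mk₀_smul, this]; simp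

lemma ext_middle [IsNoetherianRing A] (X : ModuleCat.{0} A) {M : Type} [AddCommGroup M] [Module A M]
   (F : Submodule A M) (i : ℕ) (h1 : Module.Finite A (Abelian.Ext X (ModuleCat.of A F) i))
   (h2 : Module.Finite A (Abelian.Ext X (ModuleCat.of A (M ⧸ F)) i)) :
   Module.Finite A (Abelian.Ext X (ModuleCat.of A M) i) := by
  let S : ShortComplex (ModuleCat.{0} A) := ShortComplex.mk (ModuleCat.ofHom F.subtype)
    (ModuleCat.ofHom F.mkQ) (by ext x; simp)
  have hS : S.ShortExact := ModuleCat.shortComplex_shortExact S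
    (by intro x; simp [S]) (Subtype.val_injective) (F.mkQ_surjective)
  have := isNoetherian_of_range_eq_ker
    ((Abelian.Ext.mk₀ S.f).postcompOfLinear A X (add_zero i))
    ((Abelian.Ext.mk₀ S.g).postcompOfLinear A X (add_zero i)) (by
      ext z
      constructor
      · rintro ⟨y, rfl⟩
        simp
      · intro hz
        exact Abelian.Ext.covariant_sequence_exact₂ X hS z hz)
  infer_instance

end extpart

section good
variable {A : Type} [CommRing A]

/-- `M` is killed by `x`, is `𝔞`-torsion, and its `𝔞`-torsion part is finite. -/
structure Good (x : A) (𝔞 : Ideal A) (M : Type) [AddCommGroup M] [Module A M] : Prop where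
  kill : ∀ m : M, x • m = 0
  tors : ∀ m : M, ∃ k : ℕ, ∀ a ∈ 𝔞 ^ k, a • m = 0
  fin : Module.Finite A (Submodule.torsionBySet A M (𝔞 : Set A))

lemma mem_tors {M : Type} [AddCommGroup M] [Module A M] (I : Ideal A) (m : M) :
    m ∈ Submodule.torsionBySet A M (I : Set A) ↔ ∀ a ∈ I, a • m = 0 := by
  rw [Submodule.mem_torsionBySet_iff]
  exact ⟨fun h a ha => h ⟨a, ha⟩, fun h a => h a a.2⟩

variable [IsNoetherianRing A] {x : A} {𝔞 : Ideal A}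
variable {M N P : Type} [AddCommGroup M] [Module A M] [AddCommGroup N] [Module A N]
  [AddCommGroup P] [Module A P]

/-- the map induced on torsion -/
def torsMap (I : Ideal A) (f : M →ₗ[A] N) :
    Submodule.torsionBySet A M (I : Set A) →ₗ[A] Submodule.torsionBySet A N (I : Set A) :=
  f.restrict (by
    intro m hm
    rw [mem_tors] at hm ⊢
    intro a ha
    rw [← map_smul, hm a ha, map_zero])

lemma torsMap_coe (I : Ideal A) (f : M →ₗ[A] N) (m : Submodule.torsionBySet A M (I : Set A)) :
    (torsMap I f m : N) = f m := rfl

/-- If the kernel and target are noetherian so is the source. -/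
lemma noeth_of_ker (f : M →ₗ[A] N) (h1 : IsNoetherian A (LinearMap.ker f)) (h2 : IsNoetherian A N) :
    IsNoetherian A M :=
  isNoetherian_of_range_eq_ker (LinearMap.ker f).subtype f (by simp)

lemma Good.of_injective (f : M →ₗ[A] N) (hf : Function.Injective f) (h : Good x 𝔞 N) :
    Good x 𝔞 M where
  kill m := hf (by rw [map_smul, h.kill, map_zero])
  tors m := by
    obtain ⟨k, hk⟩ := h.tors (f m)
    exact ⟨k, fun a ha => hf (by rw [map_smul, hk a ha, map_zero])⟩
  fin := by
    have := h.fin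
    refine Module.Finite.of_injective (torsMap 𝔞 f) ?_
    intro a b hab
    exact Subtype.ext (hf (congrArg Subtype.val hab))

lemma fin_pow (h : Module.Finite A (Submodule.torsionBySet A M (𝔞 : Set A))) (k : ℕ) :
    Module.Finite A (Submodule.torsionBySet A M ((𝔞 ^ k : Ideal A) : Set A)) := by
  induction k with
  | zero =>
    have : Submodule.torsionBySet A M ((𝔞 ^ 0 : Ideal A) : Set A) = ⊥ := by
      rw [eq_bot_iff]; intro m hm
      rw [mem_tors] at hm
      simpa using hm 1 (by simp)
    rw [this]; infer_instance
  | succ k ih =>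
    obtain ⟨s, hs⟩ := (IsNoetherian.noetherian 𝔞 : 𝔞.FG)
    let g : Submodule.torsionBySet A M ((𝔞 ^ (k+1) : Ideal A) : Set A) →ₗ[A]
        (s → Submodule.torsionBySet A M ((𝔞 ^ k : Ideal A) : Set A)) :=
      LinearMap.pi fun a => LinearMap.codRestrict _
        ((LinearMap.lsmul A M (a : A)) ∘ₗ Submodule.subtype _) (by
          intro m
          rw [mem_tors]
          intro b hb
          have := (mem_tors _ _).1 m.2 (b * a) (by
            rw [pow_succ]
            exact Ideal.mul_mem_mul hb (hs ▸ Submodule.subset_span a.2))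
          simpa [mul_smul] using this)
    have hg : ∀ m, g m = 0 → ∀ a ∈ 𝔞, a • (m : M) = 0 := by
      intro m hm
      have : (m : M) ∈ Submodule.torsionBySet A M (s : Set A) := by
        rw [Submodule.mem_torsionBySet_iff]
        intro a
        exact congrArg Subtype.val (congrFun hm a)
      rw [Submodule.torsionBySet_eq_torsionBySet_span] at this
      change (m : M) ∈ Submodule.torsionBySet A M ((Submodule.span A (s : Set A) : Ideal A) : Set A) at this
      rw [hs, mem_tors] at this
      exact this
    have hker : IsNoetherian A (LinearMap.ker g) := by
      refine isNoetherian_of_injective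
        (LinearMap.codRestrict (Submodule.torsionBySet A M (𝔞 : Set A))
          (Submodule.subtype _ ∘ₗ (LinearMap.ker g).subtype) ?_) ?_
      · intro m
        rw [mem_tors]
        exact hg _ m.2
      · intro a b hab
        have hab2 := congrArg Subtype.val hab; exact Subtype.ext (Subtype.ext hab2)
    have := noeth_of_ker g hker inferInstance
    infer_instance

/-- structure of good modules -/
lemma Good.decomp {n : ℕ} {c : Ideal A} [IsArtinianRing (A ⧸ (𝔞 ⊔ c))]
    (hc : ∀ r ∈ c, ∀ a ∈ 𝔞 ^ n, r * a ∈ Ideal.span {x}) (h : Good x 𝔞 M) :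
    ∃ F : Submodule A M, Module.Finite A F ∧ IsArtinian A (M ⧸ F) ∧
      ∀ r ∈ c, ∀ m : M ⧸ F, r • m = 0 := by
  let F := Submodule.torsionBySet A M ((𝔞 ^ n : Ideal A) : Set A)
  have hkill : ∀ r ∈ c, ∀ m : M ⧸ F, r • m = 0 := by
    intro r hr m
    obtain ⟨m, rfl⟩ := F.mkQ_surjective m
    rw [← map_smul, Submodule.mkQ_apply, Submodule.Quotient.mk_eq_zero, mem_tors]
    intro a ha
    obtain ⟨t, ht⟩ := Ideal.mem_span_singleton'.1 (hc r hr a ha)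
    rw [smul_smul, mul_comm a r, ← ht, mul_smul, h.kill, smul_zero]
  refine ⟨F, fin_pow h.fin n, ?_, hkill⟩
  apply artinian_ideal 𝔞
  · intro m
    obtain ⟨m, rfl⟩ := F.mkQ_surjective m
    obtain ⟨k, hk⟩ := h.tors m
    exact ⟨k, fun a ha => by rw [← map_smul, hk a ha, map_zero]⟩
  · have := finite_of_artinian_killed (𝔞 ⊔ c) (Q := Submodule.torsionBySet A (M ⧸ F) (𝔞 : Set A)) (by
      intro a ha m
      obtain ⟨u, hu, v, hv, rfl⟩ := Submodule.mem_sup.1 ha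
      apply Subtype.ext
      have h1 := (mem_tors _ _).1 m.2 u hu
      have h2 := hkill v hv m
      simp [add_smul, h1, h2])
    rw [← this]
    have := fin_pow h.fin (n+1)
    refine Module.Finite.of_surjective (LinearMap.codRestrict (Submodule.torsionBySet A (M ⧸ F) (𝔞 : Set A))
      (F.mkQ ∘ₗ (Submodule.torsionBySet A M ((𝔞 ^ (n+1) : Ideal A) : Set A)).subtype) ?_) ?_
    · intro m
      rw [mem_tors]
      intro a ha
      rw [← map_smul]
      change F.mkQ (a • (m : M)) = 0
      rw [Submodule.mkQ_apply, Submodule.Quotient.mk_eq_zero, mem_tors]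
      intro b hb
      rw [smul_smul]
      exact (mem_tors _ _).1 m.2 _ (by rw [pow_succ]; exact Ideal.mul_mem_mul hb ha)
    · rintro ⟨m, hm⟩
      obtain ⟨m, rfl⟩ := F.mkQ_surjective m
      refine ⟨⟨m, ?_⟩, rfl⟩
      rw [mem_tors] at hm ⊢
      intro a ha
      rw [pow_succ] at ha
      refine Submodule.mul_induction_on ha ?_ ?_
      · intro u hu v hv
        have := hm v hv
        rw [← map_smul, Submodule.mkQ_apply, Submodule.Quotient.mk_eq_zero, mem_tors] at this
        rw [mul_smul]; exact this u hu
      · intro u v hu hv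
        rw [add_smul, hu, hv, add_zero]

lemma Good.of_surjective (hdim : ringKrullDim (A ⧸ Ideal.span {x}) = 1)
    (f : M →ₗ[A] N) (hf : Function.Surjective f) (h : Good x 𝔞 M) :
    Good x 𝔞 N := by
  obtain ⟨n, c, J, hJ, hc, rfl⟩ := exists_colon 𝔞 x hdim
  obtain ⟨F, hF, hQ, hk⟩ := h.decomp hc
  refine ⟨?_, ?_, ?_⟩
  · intro m; obtain ⟨m, rfl⟩ := hf m; rw [← map_smul, h.kill, map_zero]
  · intro m; obtain ⟨m, rfl⟩ := hf m
    obtain ⟨k, hk⟩ := h.tors m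
    exact ⟨k, fun a ha => by rw [← map_smul, hk a ha, map_zero]⟩
  · let G := F.map f
    have hG : Module.Finite A G := inferInstance
    let φ : (M ⧸ F) →ₗ[A] (N ⧸ G) := F.mapQ G f (Submodule.le_comap_map f F)
    have hφ : Function.Surjective φ := by
      intro z
      obtain ⟨z, rfl⟩ := G.mkQ_surjective z
      obtain ⟨m, rfl⟩ := hf z
      exact ⟨F.mkQ m, rfl⟩
    have hA : IsArtinian A (N ⧸ G) := isArtinian_of_surjective _ φ hφ
    have hk' : ∀ r ∈ c, ∀ m : N ⧸ G, r • m = 0 := by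
      intro r hr m
      obtain ⟨m, rfl⟩ := hφ m
      rw [← map_smul, hk r hr, map_zero]
    have h2 : Module.Finite A (Submodule.torsionBySet A (N ⧸ G) (𝔞 : Set A)) := by
      rw [finite_of_artinian_killed (𝔞 ⊔ c)]
      · infer_instance
      · intro a ha m
        obtain ⟨u, hu, v, hv, rfl⟩ := Submodule.mem_sup.1 ha
        apply Subtype.ext
        have h1 := (mem_tors _ _).1 m.2 u hu
        have h2 := hk' v hv m
        simp [add_smul, h1, h2]
    have := noeth_of_ker (torsMap 𝔞 G.mkQ) (by
      refine isNoetherian_of_injective (LinearMap.codRestrict G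
          (Submodule.subtype _ ∘ₗ (LinearMap.ker (torsMap 𝔞 G.mkQ)).subtype) ?_) ?_
      · intro m
        have := congrArg Subtype.val m.2
        rw [torsMap_coe] at this
        simpa using this
      · intro a b hab
        have hab2 := congrArg Subtype.val hab; exact Subtype.ext (Subtype.ext hab2)) inferInstance
    infer_instance

lemma Good.of_ker (f : M →ₗ[A] N) (hx : ∀ m : M, x • m = 0) (h1 : Good x 𝔞 (LinearMap.ker f)) (h2 : Good x 𝔞 N) :
    Good x 𝔞 M where
  kill := hx
  tors m := by
    obtain ⟨k, hk⟩ := h2.tors (f m)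
    -- finitely many generators of `𝔞 ^ k`
    obtain ⟨s, hs⟩ := (IsNoetherian.noetherian (𝔞 ^ k) : (𝔞 ^ k).FG)
    have hmem : ∀ a ∈ 𝔞 ^ k, a • m ∈ LinearMap.ker f := fun a ha => by
      rw [LinearMap.mem_ker, map_smul, hk a ha]
    have : ∀ a : A, ∃ l : ℕ, a ∈ s → ∀ b ∈ 𝔞 ^ l, b • a • m = 0 := by
      intro a
      by_cases ha : a ∈ s
      · obtain ⟨l, hl⟩ := h1.tors ⟨a • m, hmem a (hs ▸ Submodule.subset_span ha)⟩
        exact ⟨l, fun _ b hb => congrArg Subtype.val (hl b hb)⟩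
      · exact ⟨0, fun h => absurd h ha⟩
    choose l hl using this
    refine ⟨s.sup l + k, fun a ha => ?_⟩
    rw [pow_add] at ha
    refine Submodule.mul_induction_on ha ?_ ?_
    · intro u hu v hv
      rw [← hs] at hv
      induction hv using Submodule.span_induction with
      | mem v hv =>
        rw [mul_smul]
        exact hl v hv u (Ideal.pow_le_pow_right (Finset.le_sup hv) hu)
      | zero => simp
      | add v w _ _ hv hw => rw [mul_add, add_smul, hv, hw, add_zero]
      | smul r v _ hv => rw [smul_eq_mul, mul_left_comm, mul_smul, hv, smul_zero]
    · intro u v hu hv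
      rw [add_smul, hu, hv, add_zero]
  fin := by
    have := h1.fin
    have := h2.fin
    have := noeth_of_ker (torsMap 𝔞 f) (by
      refine isNoetherian_of_injective (LinearMap.codRestrict (Submodule.torsionBySet A (LinearMap.ker f) (𝔞 : Set A))
          (LinearMap.codRestrict (LinearMap.ker f)
            (Submodule.subtype _ ∘ₗ (LinearMap.ker (torsMap 𝔞 f)).subtype) ?_) ?_) ?_
      · intro m
        exact congrArg Subtype.val m.2
      · intro m
        rw [mem_tors]
        intro a ha
        exact Subtype.ext ((mem_tors _ _).1 m.1.2 a ha)
      · intro a b hab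
        exact Subtype.ext (Subtype.ext (congrArg (fun z => (z.1 : M)) hab))) inferInstance
    infer_instance

/-- `range g₂` is a quotient of `range g₁`. -/
lemma Good.of_factor (hdim : ringKrullDim (A ⧸ Ideal.span {x}) = 1)
    (g₁ : M →ₗ[A] N) (g₂ : M →ₗ[A] P) (hg : LinearMap.ker g₁ ≤ LinearMap.ker g₂)
    (h : Good x 𝔞 N) : Good x 𝔞 (LinearMap.range g₂) := by
  have h1 : Good x 𝔞 (M ⧸ LinearMap.ker g₁) :=
    h.of_injective ((LinearMap.ker g₁).liftQ g₁ le_rfl)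
      (LinearMap.ker_eq_bot.1 (Submodule.ker_liftQ_eq_bot' _ _ rfl))
  refine h1.of_surjective hdim ((LinearMap.ker g₁).liftQ g₂.rangeRestrict (by simpa using hg)) ?_
  rw [← LinearMap.range_eq_top, Submodule.range_liftQ, LinearMap.range_rangeRestrict]

end good

section final
variable {A : Type} [CommRing A] [IsNoetherianRing A] {x : A} {𝔞 : Ideal A}
variable {M : Type} [AddCommGroup M] [Module A M]

lemma Good.of_cofinite (hx : ∀ m : M, x • m = 0) (h : IsCofinite 𝔞 M) : Good x 𝔞 M where
  kill := hx
  tors m := by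
    have hrad : 𝔞 ≤ (Submodule.span A {m}).annihilator.radical := by
      rw [Ideal.radical_eq_sInf]
      refine le_sInf fun p hp => ?_
      have : (⟨p, hp.2⟩ : PrimeSpectrum A) ∈ Module.support A M :=
        Module.mem_support_iff_exists_annihilator.2 ⟨m, hp.1⟩
      exact h.1 this
    obtain ⟨k, hk⟩ := Ideal.exists_pow_le_of_le_radical_of_fg hrad (IsNoetherian.noetherian _)
    exact ⟨k, fun a ha => Submodule.mem_annihilator_span_singleton _ _ |>.1 (hk ha)⟩
  fin := by
    have h0 := h.2 0
    have h1 : Module.Finite A (ModuleCat.of A (A ⧸ 𝔞) ⟶ ModuleCat.of A M) :=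
      Module.Finite.equiv (ext0Iso (ModuleCat.of A (A ⧸ 𝔞)) (ModuleCat.of A M)).toLinearEquiv
    have h2 : Module.Finite A ((A ⧸ 𝔞) →ₗ[A] M) := 
      Module.Finite.equiv (ModuleCat.homLinearEquiv (S := A) (M := ModuleCat.of A (A ⧸ 𝔞)) (N := ModuleCat.of A M))
    refine Module.Finite.of_surjective (LinearMap.codRestrict (Submodule.torsionBySet A M (𝔞 : Set A))
      (LinearMap.applyₗ (Ideal.Quotient.mk 𝔞 1) : ((A ⧸ 𝔞) →ₗ[A] M) →ₗ[A] M) ?_) ?_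
    · intro g
      rw [mem_tors]
      intro a ha
      change a • g _ = 0
      rw [← map_smul]
      have : a • (Ideal.Quotient.mk 𝔞 1) = 0 := by
        change Ideal.Quotient.mk 𝔞 (a • 1) = 0
        rw [Ideal.Quotient.eq_zero_iff_mem]; simpa using ha
      rw [this, map_zero]
    · rintro ⟨m, hm⟩
      rw [mem_tors] at hm
      refine ⟨Submodule.liftQ 𝔞 (LinearMap.toSpanSingleton A M m) ?_, ?_⟩
      · intro a ha; simpa using hm a ha
      · apply Subtype.ext
        change (1 : A) • m = m
        simp

lemma Good.cofinite (hdim : ringKrullDim (A ⧸ Ideal.span {x}) = 1) (h : Good x 𝔞 M) :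
    IsCofinite 𝔞 M := by
  obtain ⟨n, c, J, hJ, hc, rfl⟩ := exists_colon 𝔞 x hdim
  obtain ⟨F, hF, hQ, hk⟩ := h.decomp hc
  have hext : ∀ i, Module.Finite A (Abelian.Ext (ModuleCat.of A (A ⧸ 𝔞)) (ModuleCat.of A M) i) := by
    intro i
    refine ext_middle _ F i inferInstance ?_
    rw [finite_of_artinian_killed (𝔞 ⊔ c)]
    · exact artinian_ext _ _ i
    · intro a ha z
      obtain ⟨u, hu, v, hv, rfl⟩ := Submodule.mem_sup.1 ha
      rw [add_smul, ext_killed_left _ _ u ?_ i z, ext_killed_right _ _ v (hk v hv) i z, add_zero]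
      intro y
      obtain ⟨y, rfl⟩ := Ideal.Quotient.mk_surjective y
      change Ideal.Quotient.mk 𝔞 (u • y) = 0
      rw [Ideal.Quotient.eq_zero_iff_mem]; exact 𝔞.mul_mem_right y hu
  refine ⟨?_, ?_⟩
  · intro p hp
    obtain ⟨m, hm⟩ := Module.mem_support_iff_exists_annihilator.1 hp
    obtain ⟨k, hk⟩ := h.tors m
    have : 𝔞 ^ k ≤ p.asIdeal := fun a ha =>
      hm ((Submodule.mem_annihilator_span_singleton _ _).2 (hk a ha))
    exact fun a ha => p.2.mem_of_pow_mem k (this (Ideal.pow_mem_pow ha k))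
  · intro i
    cases i with
    | zero =>
      have := hext 0
      have h1 : Module.Finite A (ModuleCat.of A (A ⧸ 𝔞) ⟶ ModuleCat.of A M) :=
        Module.Finite.equiv (Abelian.Ext.linearEquiv₀ (R := A))
      have h2 : Module.Finite A (ModuleCat.of A (ModuleCat.of A (A ⧸ 𝔞) ⟶ ModuleCat.of A M)) := h1
      exact Module.Finite.equiv (ext0Iso (ModuleCat.of A (A ⧸ 𝔞)) (ModuleCat.of A M)).toLinearEquiv.symm
    | succ i => exact ext_succ_finite _ _ i (hext (i+1))

lemma kill_torsionBy (m : Submodule.torsionBy A M x) : x • m = 0 :=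
  Subtype.ext ((Submodule.mem_torsionBy_iff x _).1 m.2)

lemma mem_span_smul_top (m : M) :
    m ∈ Ideal.span {x} • (⊤ : Submodule A M) ↔ ∃ z : M, x • z = m := by
  rw [Submodule.ideal_span_singleton_smul, Submodule.mem_smul_pointwise_iff_exists]
  simp

lemma kill_quot (m : M ⧸ (Ideal.span {x} • (⊤ : Submodule A M))) : x • m = 0 := by
  obtain ⟨m, rfl⟩ := Submodule.mkQ_surjective _ m
  rw [← map_smul, Submodule.mkQ_apply, Submodule.Quotient.mk_eq_zero, mem_span_smul_top]
  exact ⟨m, rfl⟩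

variable {N : Type} [AddCommGroup N] [Module A N]

/-- induced map on `M/xM` -/
def quotMap (x : A) (f : M →ₗ[A] N) : (M ⧸ (Ideal.span {x} • (⊤ : Submodule A M))) →ₗ[A]
    (N ⧸ (Ideal.span {x} • (⊤ : Submodule A N))) :=
  Submodule.mapQ _ _ f (by
    intro m hm
    obtain ⟨z, rfl⟩ := (mem_span_smul_top m).1 hm
    rw [Submodule.mem_comap, mem_span_smul_top]
    exact ⟨f z, by simp⟩)

lemma quotMap_surj (f : M →ₗ[A] N) (hf : Function.Surjective f) :
    Function.Surjective (quotMap x f) := by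
  intro z
  obtain ⟨z, rfl⟩ := Submodule.mkQ_surjective _ z
  obtain ⟨m, rfl⟩ := hf z
  exact ⟨Submodule.mkQ _ m, rfl⟩

/-- induced map on `(0 :_M x)` -/
def torMap (x : A) (f : M →ₗ[A] N) : Submodule.torsionBy A M x →ₗ[A] Submodule.torsionBy A N x :=
  f.restrict (by
    intro m hm
    rw [Submodule.mem_torsionBy_iff] at hm ⊢
    rw [← map_smul, hm, map_zero])

lemma torMap_inj (f : M →ₗ[A] N) (hf : Function.Injective f) :
    Function.Injective (torMap x f) := by
  intro a b hab
  exact Subtype.ext (hf (congrArg Subtype.val hab))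

end final

/-- For a single element `x` with `dim A/xA = 1`: if `(0 :_M x)`, `M/xM`, `(0 :_N x)`,
`N/xN` are `𝔞`-cofinite and `f : M ⟶ N` is any homomorphism, then the corresponding
four modules attached to `Ker f` and `Coker f` are `𝔞`-cofinite; that is, the category
`𝒦ℳ(x,𝔞,A)_cof` is abelian. -/
theorem stmt14 [IsNoetherianRing A] (𝔞 : Ideal A) (x : A)
    (hdim : ringKrullDim (A ⧸ Ideal.span {x}) = 1)
    (M N : Type) [AddCommGroup M] [Module A M] [AddCommGroup N] [Module A N]
    (hM0 : IsCofinite 𝔞 ↥(Submodule.torsionBy A M x))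
    (hM1 : IsCofinite 𝔞 (M ⧸ (Ideal.span {x} • (⊤ : Submodule A M))))
    (hN0 : IsCofinite 𝔞 ↥(Submodule.torsionBy A N x))
    (hN1 : IsCofinite 𝔞 (N ⧸ (Ideal.span {x} • (⊤ : Submodule A N))))
    (f : M →ₗ[A] N) :
    IsCofinite 𝔞 ↥(Submodule.torsionBy A ↥(LinearMap.ker f) x) ∧
    IsCofinite 𝔞 (↥(LinearMap.ker f) ⧸
      (Ideal.span {x} • (⊤ : Submodule A ↥(LinearMap.ker f)))) ∧
    IsCofinite 𝔞 ↥(Submodule.torsionBy A (N ⧸ LinearMap.range f) x) ∧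
    IsCofinite 𝔞 ((N ⧸ LinearMap.range f) ⧸
      (Ideal.span {x} • (⊤ : Submodule A (N ⧸ LinearMap.range f)))) := by
  have gM0 : Good x 𝔞 _ := Good.of_cofinite kill_torsionBy hM0
  have gM1 : Good x 𝔞 _ := Good.of_cofinite kill_quot hM1
  have gN0 : Good x 𝔞 _ := Good.of_cofinite kill_torsionBy hN0
  have gN1 : Good x 𝔞 _ := Good.of_cofinite kill_quot hN1
  refine ⟨Good.cofinite hdim ?_, Good.cofinite hdim ?_, Good.cofinite hdim ?_,
    Good.cofinite hdim ?_⟩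
  · exact gM0.of_injective (torMap x (LinearMap.ker f).subtype)
      (torMap_inj _ Subtype.val_injective)
  · -- `(Ker f)/x(Ker f)`
    let K := LinearMap.ker f
    let U : Submodule A M := LinearMap.ker (x • f)
    have hU : ∀ u : U, x • f u = 0 := fun u => u.2
    let g₁ : U →ₗ[A] Submodule.torsionBy A N x :=
      LinearMap.codRestrict _ (f ∘ₗ U.subtype) (fun u => (Submodule.mem_torsionBy_iff x _).2 (hU u))
    let g₂' : U →ₗ[A] K :=
      LinearMap.codRestrict _ (LinearMap.lsmul A M x ∘ₗ U.subtype)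
        (fun u => by simpa [K] using hU u)
    let g₂ := (Ideal.span {x} • (⊤ : Submodule A K)).mkQ ∘ₗ g₂'
    have hg : LinearMap.ker g₁ ≤ LinearMap.ker g₂ := by
      intro u hu
      have hu' : f u = 0 := congrArg Subtype.val hu
      change Submodule.mkQ _ (g₂' u) = 0
      rw [Submodule.mkQ_apply, Submodule.Quotient.mk_eq_zero, mem_span_smul_top]
      exact ⟨⟨u, hu'⟩, rfl⟩
    have h2 := gN0.of_factor hdim g₁ g₂ hg
    refine Good.of_ker (quotMap x K.subtype) kill_quot ?_ gM1
    have hle : LinearMap.ker (quotMap x K.subtype) ≤ LinearMap.range g₂ := by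
      intro z hz
      obtain ⟨k, rfl⟩ := Submodule.mkQ_surjective _ z
      change Submodule.mkQ _ (k : M) = 0 at hz
      rw [Submodule.mkQ_apply, Submodule.Quotient.mk_eq_zero, mem_span_smul_top] at hz
      obtain ⟨m, hm⟩ := hz
      refine ⟨⟨m, ?_⟩, ?_⟩
      · change x • f m = 0
        rw [← map_smul, hm]; exact k.2
      · change Submodule.mkQ _ (g₂' ⟨m, _⟩) = _
        congr 1
        exact Subtype.ext hm
    exact h2.of_injective (Submodule.inclusion hle) (Submodule.inclusion_injective hle)
  · -- `(0 :_{Coker f} x)`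
    let I := LinearMap.range f
    have gI : Good x 𝔞 (I ⧸ (Ideal.span {x} • (⊤ : Submodule A I))) :=
      gM1.of_surjective hdim (quotMap x f.rangeRestrict) (quotMap_surj _ f.surjective_rangeRestrict)
    let U : Submodule A N := I.comap (LinearMap.lsmul A N x)
    have hU : ∀ u : U, x • (u : N) ∈ I := fun u => u.2
    let π : U →ₗ[A] Submodule.torsionBy A (N ⧸ I) x :=
      LinearMap.codRestrict _ (I.mkQ ∘ₗ U.subtype) (fun u => by
        rw [Submodule.mem_torsionBy_iff]
        change x • I.mkQ (u : N) = 0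
        rw [← map_smul, Submodule.mkQ_apply, Submodule.Quotient.mk_eq_zero]
        exact hU u)
    have hπ : Function.Surjective π := by
      rintro ⟨z, hz⟩
      obtain ⟨n, rfl⟩ := I.mkQ_surjective z
      rw [Submodule.mem_torsionBy_iff, ← map_smul, Submodule.mkQ_apply,
        Submodule.Quotient.mk_eq_zero] at hz
      exact ⟨⟨n, hz⟩, rfl⟩
    let δ₀ : U →ₗ[A] I := LinearMap.codRestrict _ (LinearMap.lsmul A N x ∘ₗ U.subtype) hU
    let δ' := (Ideal.span {x} • (⊤ : Submodule A I)).mkQ ∘ₗ δ₀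
    have hker : LinearMap.ker π ≤ LinearMap.ker δ' := by
      intro u hu
      have hu' : I.mkQ (u : N) = 0 := congrArg Subtype.val hu
      rw [Submodule.mkQ_apply, Submodule.Quotient.mk_eq_zero] at hu'
      change Submodule.mkQ _ (δ₀ u) = 0
      rw [Submodule.mkQ_apply, Submodule.Quotient.mk_eq_zero, mem_span_smul_top]
      exact ⟨⟨u, hu'⟩, rfl⟩
    let δ := (LinearMap.ker π).liftQ δ' hker ∘ₗ (π.quotKerEquivOfSurjective hπ).symm.toLinearMap
    have hδ : ∀ u, δ (π u) = δ' u := by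
      intro u
      have : (π.quotKerEquivOfSurjective hπ).symm (π u) = (LinearMap.ker π).mkQ u := by
        rw [LinearEquiv.symm_apply_eq]; rfl
      change (LinearMap.ker π).liftQ δ' hker ((π.quotKerEquivOfSurjective hπ).symm (π u)) = _
      rw [this]; rfl
    refine Good.of_ker δ kill_torsionBy ?_ gI
    have h2 := gN0.of_factor hdim LinearMap.id (torMap x I.mkQ) (by simp)
    have hle : LinearMap.ker δ ≤ LinearMap.range (torMap x I.mkQ) := by
      intro z hz
      obtain ⟨u, rfl⟩ := hπ z
      rw [LinearMap.mem_ker, hδ] at hz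
      change Submodule.mkQ _ (δ₀ u) = 0 at hz
      rw [Submodule.mkQ_apply, Submodule.Quotient.mk_eq_zero, mem_span_smul_top] at hz
      obtain ⟨i, hi⟩ := hz
      have hi' : x • (i : N) = x • (u : N) := congrArg Subtype.val hi
      refine ⟨⟨(u : N) - i, ?_⟩, ?_⟩
      · rw [Submodule.mem_torsionBy_iff, smul_sub, hi', sub_self]
      · apply Subtype.ext
        change I.mkQ ((u : N) - i) = I.mkQ u
        rw [map_sub, sub_eq_self, Submodule.mkQ_apply, Submodule.Quotient.mk_eq_zero]
        exact i.2
    exact h2.of_injective (Submodule.inclusion hle) (Submodule.inclusion_injective hle)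
  · exact gN1.of_surjective hdim (quotMap x (LinearMap.range f).mkQ)
      (quotMap_surj _ (Submodule.mkQ_surjective _))

end
end
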